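/- arXiv:1710.07664 — 6 statements merged into one kernel-verified Lean document; each statement's English description precedes it below -/
import Mathlib

section
/- Let k ≥ 2 be an integer. Every ordered graph on n vertices that contains no bordered cycle of length 2l for any 2 ≤ l ≤ k has fewer than 3k·n^{1+1/k} edges. -/
/-- `HasBorderedCycleWith G l outer inner` says that the ordered graph `G` (a simple graph on a
linearly ordered vertex set) contains a bordered cycle of length `2 * l` whose outer border is
the pair `outer` and whose inner border is the pair `inner`.  That is, there are vertices
`u 0 < u 1 < ⋯ < u (l-1) < v 0 < v 1 < ⋯ < v (l-1)` and a cycle of length `2 * l` in `G` on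
these `2 * l` vertices, every edge of which joins some `u i` to some `v j`, such that both the
pair `{u 0, v (l-1)}` (the outer border) and the pair `{u (l-1), v 0}` (the inner border) are
edges of the cycle; moreover `outer = {u 0, v (l-1)}` and `inner = {u (l-1), v 0}`.
Since every edge of the cycle joins a `u i` to a `v j`, the cycle alternates between the `u`'s
and the `v`'s, so it can be encoded by a pair of permutations `a b` of `Fin l`: the cycle
visits `u (a 0), v (b 0), u (a 1), v (b 1), …, u (a (l-1)), v (b (l-1))` and returns to
`u (a 0)`.  Its edges are thus the pairs `{u (a s), v (b s)}` and `{u (a (s+1)), v (b s)}`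
(with `s + 1` taken cyclically in `Fin l`). -/
def HasBorderedCycleWith {V : Type*} [LinearOrder V] (G : SimpleGraph V) (l : ℕ)
    (outer inner : Sym2 V) : Prop :=
  ∃ m : ℕ, l = m + 2 ∧ ∃ (u v : Fin (m + 2) → V) (a b : Equiv.Perm (Fin (m + 2))),
    StrictMono u ∧ StrictMono v ∧ u (Fin.last (m + 1)) < v 0 ∧
    (∀ s, G.Adj (u (a s)) (v (b s))) ∧
    (∀ s, G.Adj (u (a (s + 1))) (v (b s))) ∧
    (∃ s, (a s = 0 ∧ b s = Fin.last (m + 1)) ∨ (a (s + 1) = 0 ∧ b s = Fin.last (m + 1))) ∧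
    (∃ s, (a s = Fin.last (m + 1) ∧ b s = 0) ∨ (a (s + 1) = Fin.last (m + 1) ∧ b s = 0)) ∧
    outer = s(u 0, v (Fin.last (m + 1))) ∧ inner = s(u (Fin.last (m + 1)), v 0)

/-- The ordered graph `G` contains a bordered cycle of length `2 * l`. -/
def HasBorderedCycle {V : Type*} [LinearOrder V] (G : SimpleGraph V) (l : ℕ) : Prop :=
  ∃ outer inner, HasBorderedCycleWith G l outer inner

open Finset in
theorem Finset.card_le_of_forall_card_filter_lt {α : Type*} (A : Finset α) (R : α → α → Prop)
    [DecidableRel R] (t : ℕ) (hA : A.Nonempty → ∃ x ∈ A, ∀ w ∈ A, w ≠ x → R x w)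
    (h : ∀ x ∈ A, #{w ∈ A | R x w} < t) : #A ≤ t := by
  classical
  rcases A.eq_empty_or_nonempty with rfl | hne
  · simp
  obtain ⟨x, hx, hxw⟩ := hA hne
  have h1 : A.erase x ⊆ {w ∈ A | R x w} := fun w hw => by
    rw [mem_erase] at hw
    exact mem_filter.2 ⟨hw.2, hxw w hw.2 hw.1⟩
  have h2 := card_le_card h1
  have h3 := h x hx
  rw [card_erase_of_mem hx] at h2
  omega

/-- `w` lies strictly between `x` and `y`, in either order. -/
def StrictlyBetween {V : Type*} [LinearOrder V] (x w y : V) : Prop :=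
  (x < w ∧ w < y) ∨ (y < w ∧ w < x)

open Finset in
open scoped Classical in
theorem Finset.card_le_of_forall_card_filter_strictlyBetween {V : Type*} [LinearOrder V]
    (A : Finset V) (y : V) (t : ℕ) (hy : y ∉ A)
    (h : ∀ x ∈ A, #{w ∈ A | StrictlyBetween x w y} < t) : #A ≤ 2 * t := by
  have h1 : #{x ∈ A | x < y} ≤ t := by
    refine Finset.card_le_of_forall_card_filter_lt _ (fun x w => x < w) t
      (fun hne => ⟨_, min'_mem _ hne, fun w hw hwx => lt_of_le_of_ne (min'_le _ w hw) hwx.symm⟩)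
      fun x hx => lt_of_le_of_lt (card_le_card fun w hw => ?_) (h x (mem_filter.1 hx).1)
    simp only [mem_filter] at hw ⊢
    exact ⟨hw.1.1, Or.inl ⟨hw.2, hw.1.2⟩⟩
  have h2 : #{x ∈ A | y < x} ≤ t := by
    refine Finset.card_le_of_forall_card_filter_lt _ (fun x w => w < x) t
      (fun hne => ⟨_, max'_mem _ hne, fun w hw hwx => lt_of_le_of_ne (le_max' _ w hw) hwx⟩)
      fun x hx => lt_of_le_of_lt (card_le_card fun w hw => ?_) (h x (mem_filter.1 hx).1)
    simp only [mem_filter] at hw ⊢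
    exact ⟨hw.1.1, Or.inr ⟨hw.1.2, hw.2⟩⟩
  have h3 : A ⊆ {x ∈ A | x < y} ∪ {x ∈ A | y < x} := fun x hx => by
    have hne : x ≠ y := ne_of_mem_of_not_mem hx hy
    simpa [hx] using hne.lt_or_gt
  have h4 := (card_le_card h3).trans (card_union_le _ _)
  omega

/-- The first `m` edges of the sequence `P` form a walk in `G` in which every edge is nested
inside the preceding one. -/
structure IsShrinkingWalk {V : Type*} [LinearOrder V] (G : SimpleGraph V) (m : ℕ) (P : ℕ → V) :
    Prop where
  adj : ∀ i < m, G.Adj (P i) (P (i + 1))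
  between : ∀ i, i + 2 ≤ m → StrictlyBetween (P i) (P (i + 2)) (P (i + 1))

namespace IsShrinkingWalk

variable {V : Type*} [LinearOrder V] {G : SimpleGraph V} {m : ℕ} {P : ℕ → V}

theorem dual (h : IsShrinkingWalk G m P) : IsShrinkingWalk (V := Vᵒᵈ) G m P :=
  ⟨h.adj, fun i hi => (h.between i hi).symm.imp And.symm And.symm⟩

theorem cons (h : IsShrinkingWalk G m P) {x : V} (hx : G.Adj x (P 0))
    (hb : StrictlyBetween x (P 1) (P 0)) :
    IsShrinkingWalk G (m + 1) (fun i => Nat.casesOn i x P) := by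
  refine ⟨fun i hi => ?_, fun i hi => ?_⟩
  · cases i with
    | zero => exact hx
    | succ i => exact h.adj i (by omega)
  · cases i with
    | zero => exact hb
    | succ i => exact h.between i (by omega)

theorem lt_succ (h : IsShrinkingWalk G m P) (h0 : P 0 < P 1) (i : ℕ) (hi : i < m) :
    (Even i → P i < P (i + 1)) ∧ (Odd i → P (i + 1) < P i) := by
  induction i with
  | zero => exact ⟨fun _ => h0, fun h => by simp at h⟩
  | succ i ih =>
    have ih := ih (by omega)
    have hb := h.between i (by omega)
    unfold StrictlyBetween at hb
    rcases Nat.even_or_odd i with he | ho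
    · have := ih.1 he
      refine ⟨fun h' => absurd h' (by simp [Nat.even_add_one, he]), fun _ => ?_⟩
      rcases hb with hb | hb
      · exact hb.2
      · exact absurd (hb.1.trans hb.2) this.not_gt
    · have := ih.2 ho
      refine ⟨fun _ => ?_, fun h' => absurd h' (by simp [Nat.odd_add_one, ho])⟩
      rcases hb with hb | hb
      · exact absurd (hb.1.trans hb.2) this.not_gt
      · exact hb.1

/-- Later vertices stay inside the interval spanned by an earlier edge. -/
theorem nested (h : IsShrinkingWalk G m P) (h0 : P 0 < P 1) (i d : ℕ) (hi : i + 1 + d ≤ m) :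
    (Even i → P i < P (i + 1 + d) ∧ P (i + 1 + d) ≤ P (i + 1)) ∧
      (Odd i → P (i + 1) ≤ P (i + 1 + d) ∧ P (i + 1 + d) < P i) := by
  induction d using Nat.strong_induction_on with
  | _ d ih =>
    match d, ih, hi with
    | 0, _, hi =>
      have := h.lt_succ h0 i (by omega)
      exact ⟨fun he => ⟨this.1 he, le_rfl⟩, fun ho => ⟨le_rfl, this.2 ho⟩⟩
    | 1, _, hi =>
      have := h.lt_succ h0 i (by omega)
      have hb := h.between i (by omega)
      unfold StrictlyBetween at hb
      change (Even i → P i < P (i + 2) ∧ P (i + 2) ≤ P (i + 1)) ∧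
        (Odd i → P (i + 1) ≤ P (i + 2) ∧ P (i + 2) < P i)
      refine ⟨fun he => ?_, fun ho => ?_⟩
      · have := this.1 he
        grind
      · have := this.2 ho
        grind
    | d + 2, ih, hi =>
      have h1 := ih d (by omega) (by omega)
      have h2 := ih (d + 1) (by omega) (by omega)
      have hb := h.between (i + 1 + d) (by omega)
      unfold StrictlyBetween at hb
      simp only [← add_assoc] at h2 ⊢
      refine ⟨fun he => ?_, fun ho => ?_⟩
      · have := h1.1 he
        have := h2.1 he
        grind
      · have := h1.2 ho
        have := h2.2 ho
        grind

theorem lt_of_even (h : IsShrinkingWalk G m P) (h0 : P 0 < P 1) {i j : ℕ} (he : Even i)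
    (hij : i < j) (hj : j ≤ m) : P i < P j := by
  obtain ⟨d, rfl⟩ := Nat.exists_eq_add_of_lt hij
  have := ((h.nested h0 i d (by omega)).1 he).1
  rwa [show i + d + 1 = i + 1 + d by omega]

theorem lt_of_odd (h : IsShrinkingWalk G m P) (h0 : P 0 < P 1) {i j : ℕ} (ho : Odd i)
    (hij : i < j) (hj : j ≤ m) : P j < P i := by
  obtain ⟨d, rfl⟩ := Nat.exists_eq_add_of_lt hij
  have := ((h.nested h0 i d (by omega)).2 ho).2
  rwa [show i + d + 1 = i + 1 + d by omega]

theorem injective (h : IsShrinkingWalk G m P) (h0 : P 0 < P 1) {i j : ℕ} (hi : i ≤ m)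
    (hj : j ≤ m) (hij : P i = P j) : i = j := by
  have key : ∀ i j : ℕ, i < j → j ≤ m → P i ≠ P j := fun i j hij hj => by
    rcases Nat.even_or_odd i with he | ho
    · exact (h.lt_of_even h0 he hij hj).ne
    · exact (h.lt_of_odd h0 ho hij hj).ne'
  rcases lt_trichotomy i j with hlt | heq | hlt
  · exact absurd hij (key i j hlt hj)
  · exact heq
  · exact absurd hij.symm (key j i hlt hi)

theorem le_of_even (h : IsShrinkingWalk G m P) (h0 : P 0 < P 1) {i j : ℕ} (he : Even i)
    (hij : i ≤ j) (hj : j ≤ m) : P i ≤ P j := by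
  rcases hij.eq_or_lt with rfl | hij
  · exact le_rfl
  · exact (h.lt_of_even h0 he hij hj).le

theorem le_of_odd (h : IsShrinkingWalk G m P) (h0 : P 0 < P 1) {i j : ℕ} (ho : Odd i)
    (hij : i ≤ j) (hj : j ≤ m) : P j ≤ P i := by
  rcases hij.eq_or_lt with rfl | hij
  · exact le_rfl
  · exact (h.lt_of_odd h0 ho hij hj).le

end IsShrinkingWalk

namespace HasBorderedCycle

variable {V : Type*} [LinearOrder V] {G : SimpleGraph V}

theorem of_dual {l : ℕ} (h : HasBorderedCycle (V := Vᵒᵈ) G l) : HasBorderedCycle G l := by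
  obtain ⟨-, -, m, hl, u, v, a, b, hu, hv, huv, h1, h2, ⟨s, hs⟩, ⟨s', hs'⟩, -, -⟩ := h
  refine ⟨_, _, m, hl, fun i => v i.rev, fun i => u i.rev, b.trans Fin.revPerm,
    ((Equiv.addRight 1).trans a).trans Fin.revPerm, ?_, ?_, ?_, ?_, ?_, ?_, ?_, rfl, rfl⟩
  · exact fun i j hij => hv (Fin.rev_lt_rev.2 hij)
  · exact fun i j hij => hu (Fin.rev_lt_rev.2 hij)
  · have h : u (Fin.rev 0) < v (Fin.rev (Fin.last (m + 1))) := by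
      rwa [Fin.rev_last, Fin.rev_zero]
    exact h
  · intro s
    simpa using (h2 s).symm
  · intro s
    simpa using (h1 (s + 1)).symm
  · rcases hs with hs | hs
    · exact ⟨s - 1, Or.inr (by simp [hs])⟩
    · exact ⟨s, Or.inl (by simp [hs])⟩
  · rcases hs' with hs | hs
    · exact ⟨s' - 1, Or.inr (by simp [hs])⟩
    · exact ⟨s', Or.inl (by simp [hs])⟩

/-- A bordered cycle may be given by an unsorted alternating enumeration of its vertices. -/
theorem of_alternating {m : ℕ} {X Y : Fin (m + 2) → V} (hX : Function.Injective X)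
    (hY : Function.Injective Y) (h1 : ∀ s, G.Adj (X s) (Y s)) (h2 : ∀ s, G.Adj (X (s + 1)) (Y s))
    (ho : ∃ s i, (i = s ∨ i = s + 1) ∧ ∀ t, X i ≤ X t ∧ Y t ≤ Y s)
    (hi : ∃ s i, (i = s ∨ i = s + 1) ∧ X i < Y s ∧ ∀ t, X t ≤ X i ∧ Y s ≤ Y t) :
    HasBorderedCycle G (m + 2) := by
  have hu : StrictMono (X ∘ Tuple.sort X) :=
    (Tuple.monotone_sort X).strictMono_of_injective (hX.comp (Tuple.sort X).injective)
  have hv : StrictMono (Y ∘ Tuple.sort Y) :=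
    (Tuple.monotone_sort Y).strictMono_of_injective (hY.comp (Tuple.sort Y).injective)
  have min_eq : ∀ {Z : Fin (m + 2) → V}, StrictMono (Z ∘ Tuple.sort Z) → ∀ i, (∀ t, Z i ≤ Z t) →
      (Tuple.sort Z).symm i = 0 := fun {Z} hZ i h => by
    have := h (Tuple.sort Z 0)
    have h' : (Z ∘ Tuple.sort Z) ((Tuple.sort Z).symm i) ≤ (Z ∘ Tuple.sort Z) 0 := by simpa
    exact le_antisymm (hZ.le_iff_le.1 h') (Fin.zero_le _)
  have max_eq : ∀ {Z : Fin (m + 2) → V}, StrictMono (Z ∘ Tuple.sort Z) → ∀ i, (∀ t, Z t ≤ Z i) →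
      (Tuple.sort Z).symm i = Fin.last (m + 1) := fun {Z} hZ i h => by
    have := h (Tuple.sort Z (Fin.last (m + 1)))
    have h' : (Z ∘ Tuple.sort Z) (Fin.last (m + 1)) ≤
        (Z ∘ Tuple.sort Z) ((Tuple.sort Z).symm i) := by simpa
    exact le_antisymm (Fin.le_last _) (hZ.le_iff_le.1 h')
  obtain ⟨s, i, his, hsi⟩ := ho
  obtain ⟨s', i', his', hlt, hsi'⟩ := hi
  have e1 := min_eq hu i fun t => (hsi t).1
  have e2 := max_eq hv s fun t => (hsi t).2
  have e3 := max_eq hu i' fun t => (hsi' t).1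
  have e4 := min_eq hv s' fun t => (hsi' t).2
  refine ⟨_, _, m, rfl, X ∘ Tuple.sort X, Y ∘ Tuple.sort Y, (Tuple.sort X).symm,
    (Tuple.sort Y).symm, hu, hv, ?_, ?_, ?_, ⟨s, ?_⟩, ⟨s', ?_⟩, rfl, rfl⟩
  · rw [← e3, ← e4]
    simpa using hlt
  · simpa using h1
  · simpa using h2
  · rcases his with rfl | rfl
    · exact Or.inl ⟨e1, e2⟩
    · exact Or.inr ⟨e1, e2⟩
  · rcases his' with rfl | rfl
    · exact Or.inl ⟨e3, e4⟩
    · exact Or.inr ⟨e3, e4⟩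

theorem of_closed_sequence {m : ℕ} {c : ℕ → V} (hc : c (2 * (m + 2)) = c 0)
    (hinj : ∀ i < 2 * (m + 2), ∀ j < 2 * (m + 2), c i = c j → i = j)
    (hadj : ∀ i < 2 * (m + 2), G.Adj (c i) (c (i + 1)))
    (ho : ∀ i < 2 * (m + 2), (Even i → c 0 ≤ c i) ∧ (Odd i → c i ≤ c 1))
    (hi : ∃ e o, o < 2 * (m + 2) ∧ Even e ∧ Odd o ∧ (e = o + 1 ∨ o = e + 1) ∧ c e < c o ∧
      ∀ i < 2 * (m + 2), (Even i → c i ≤ c e) ∧ (Odd i → c o ≤ c i)) :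
    HasBorderedCycle G (m + 2) := by
  have hsucc : ∀ s : Fin (m + 2), c (2 * (s + 1 : Fin (m + 2)).val) = c (2 * s.val + 2) := by
    intro s
    rw [Fin.val_add_one]
    split_ifs with hs
    · rw [hs, Fin.val_last, mul_zero, ← hc]
      rfl
    · rfl
  refine of_alternating (X := fun s => c (2 * s.val)) (Y := fun s => c (2 * s.val + 1))
    ?_ ?_ ?_ ?_ ?_ ?_
  · intro s t h
    have := hinj (2 * s.val) (by omega) (2 * t.val) (by omega) h
    exact Fin.ext (by omega)
  · intro s t h
    have := hinj (2 * s.val + 1) (by omega) (2 * t.val + 1) (by omega) h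
    exact Fin.ext (by omega)
  · exact fun s => hadj _ (by omega)
  · intro s
    simp only [hsucc]
    exact (hadj (2 * s.val + 1) (by omega)).symm
  · exact ⟨0, 0, Or.inl rfl, fun t => ⟨(ho _ (by omega)).1 (by simp),
      (ho _ (by omega)).2 (by simp)⟩⟩
  · obtain ⟨e, o, ho', he, ⟨s, rfl⟩, heo, hlt, hall⟩ := hi
    have hmem : ∀ t : Fin (m + 2), c (2 * t.val) ≤ c e ∧ c (2 * s + 1) ≤ c (2 * t.val + 1) :=
      fun t => ⟨(hall _ (by omega)).1 (by simp), (hall _ (by omega)).2 (by simp)⟩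
    refine ⟨⟨s, by omega⟩, ?_⟩
    rcases heo with rfl | heo
    · refine ⟨_, Or.inr rfl, ?_⟩
      simp only [hsucc]
      exact ⟨hlt, hmem⟩
    · obtain rfl : e = 2 * s := by omega
      exact ⟨_, Or.inl rfl, hlt, hmem⟩

end HasBorderedCycle

namespace IsShrinkingWalk

variable {V : Type*} [LinearOrder V] {G : SimpleGraph V} {k : ℕ} {P Q : ℕ → V}

theorem exists_hasBorderedCycle_of_lt_of_lt (hP : IsShrinkingWalk G k P)
    (hQ : IsShrinkingWalk G k Q) (h0 : P 0 = Q 0) (hk : P k = Q k) (hk0 : 0 < k)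
    (hQ0 : Q 0 < Q 1) (hQP : Q 1 < P 1) :
    ∃ l, 2 ≤ l ∧ l ≤ k ∧ HasBorderedCycle G l := by
  classical
  have hP0 : P 0 < P 1 := by rw [h0]; exact hQ0.trans hQP
  have hex : ∃ r, 1 ≤ r ∧ ∃ s, 1 ≤ s ∧ s ≤ k ∧ P r = Q s := ⟨k, hk0, k, hk0, le_rfl, hk⟩
  obtain ⟨hr1, s, hs1, hsk, hrs⟩ := Nat.find_spec hex
  have hmin : ∀ i < Nat.find hex, 1 ≤ i → ∀ j, 1 ≤ j → j ≤ k → P i ≠ Q j :=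
    fun i hi hi1 j hj1 hjk hij => Nat.find_min hex hi ⟨hi1, j, hj1, hjk, hij⟩
  have hrk : Nat.find hex ≤ k := Nat.find_min' hex ⟨hk0, k, hk0, le_rfl, hk⟩
  generalize Nat.find hex = r at *
  have hpar : Even r ↔ Even s := by
    by_contra hne
    have hrs' : ¬ (r = k ∧ s = k) := fun h => hne (by rw [h.1, h.2])
    rcases Nat.even_or_odd r with he | ho
    · have ho : Odd s := Nat.not_even_iff_odd.1 fun h => hne ⟨fun _ => h, fun _ => he⟩
      have h1 := hP.le_of_even hP0 he hrk le_rfl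
      have h2 := hQ.le_of_odd hQ0 ho hsk le_rfl
      have h3 := hP.injective hP0 hrk le_rfl (le_antisymm h1 (by rw [hk, hrs]; exact h2))
      have h4 := hQ.injective hQ0 hsk le_rfl (by rw [← hk, ← hrs, h3])
      exact hrs' ⟨h3, h4⟩
    · have he : Even s := by
        by_contra h
        exact hne ⟨fun h' => absurd h' (Nat.not_even_iff_odd.2 ho), fun h' => absurd h' h⟩
      have h1 := hP.le_of_odd hP0 ho hrk le_rfl
      have h2 := hQ.le_of_even hQ0 he hsk le_rfl
      have h3 := hP.injective hP0 hrk le_rfl (le_antisymm (by rw [hk, hrs]; exact h2) h1)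
      have h4 := hQ.injective hQ0 hsk le_rfl (by rw [← hk, ← hrs, h3])
      exact hrs' ⟨h3, h4⟩
  obtain ⟨l, hl⟩ : Even (r + s) := Nat.even_add.2 hpar
  have hl2 : 2 ≤ l := by
    by_contra hlt
    obtain rfl : r = 1 := by omega
    obtain rfl : s = 1 := by omega
    exact hQP.ne' hrs
  obtain ⟨m, rfl⟩ : ∃ m, l = m + 2 := ⟨l - 2, by omega⟩
  refine ⟨m + 2, hl2, by omega, ?_⟩
  have hlow : ∀ i, i ≤ r → (fun i => if i ≤ r then P i else Q (r + s - i)) i = P i :=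
    fun i hi => if_pos hi
  have hhigh : ∀ i, r ≤ i → (fun i => if i ≤ r then P i else Q (r + s - i)) i = Q (r + s - i) := by
    intro i hi
    rcases hi.eq_or_lt with rfl | hi
    · simpa using hrs
    · exact if_neg (by omega)
  generalize (fun i => if i ≤ r then P i else Q (r + s - i)) = c at hlow hhigh
  have hall : ∀ p : V → Prop, (∀ i ≤ r, Even i → p (P i)) → (∀ j ≤ s, Even j → p (Q j)) →
      ∀ i < 2 * (m + 2), Even i → p (c i) := by
    intro p h1 h2 i hi he
    rcases le_total i r with h | h
    · rw [hlow i h]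
      exact h1 i h he
    · rw [hhigh i h]
      refine h2 _ (by omega) ?_
      rw [Nat.even_iff] at he ⊢
      omega
  have hall' : ∀ p : V → Prop, (∀ i ≤ r, Odd i → p (P i)) → (∀ j ≤ s, Odd j → p (Q j)) →
      ∀ i < 2 * (m + 2), Odd i → p (c i) := by
    intro p h1 h2 i hi he
    rcases le_total i r with h | h
    · rw [hlow i h]
      exact h1 i h he
    · rw [hhigh i h]
      refine h2 _ (by omega) ?_
      rw [Nat.odd_iff] at he ⊢
      omega
  refine HasBorderedCycle.of_closed_sequence (c := c) ?_ ?_ ?_ ?_ ?_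
  · rw [hlow 0 (by omega), hhigh _ (by omega), h0]
    congr 1
    omega
  · have hne : ∀ i j, i ≤ r → r < j → j < 2 * (m + 2) → c i ≠ c j := by
      intro i j hi hj hj' hij
      rw [hlow i hi, hhigh j hj.le] at hij
      rcases Nat.eq_zero_or_pos i with rfl | hi0
      · rw [h0] at hij
        have := hQ.injective hQ0 (by omega) (by omega) hij
        omega
      · rcases hi.eq_or_lt with rfl | hi
        · rw [hrs] at hij
          have := hQ.injective hQ0 (by omega) (by omega) hij
          omega
        · exact hmin i hi hi0 _ (by omega) (by omega) hij
    intro i hi j hj hij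
    rcases le_or_gt i r with h1 | h1 <;> rcases le_or_gt j r with h2 | h2
    · rw [hlow i h1, hlow j h2] at hij
      exact hP.injective hP0 (by omega) (by omega) hij
    · exact absurd hij (hne i j h1 h2 hj)
    · exact absurd hij.symm (hne j i h2 h1 hi)
    · rw [hhigh i h1.le, hhigh j h2.le] at hij
      have := hQ.injective hQ0 (by omega) (by omega) hij
      omega
  · intro i hi
    rcases lt_or_ge i r with h | h
    · rw [hlow i h.le, hlow (i + 1) h]
      exact hP.adj i (by omega)
    · rw [hhigh i h, hhigh (i + 1) (by omega)]
      have := (hQ.adj (r + s - (i + 1)) (by omega)).symm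
      rwa [show r + s - (i + 1) + 1 = r + s - i by omega] at this
  · rw [hlow 0 (by omega), hlow 1 hr1]
    refine fun i hi => ⟨hall (fun z => P 0 ≤ z) ?_ ?_ i hi, hall' (fun z => z ≤ P 1) ?_ ?_ i hi⟩
    · exact fun i hi _ => hP.le_of_even hP0 (by simp) (by omega) (by omega)
    · exact fun i hi _ => h0 ▸ hQ.le_of_even hQ0 (by simp) (by omega) (by omega)
    · exact fun i hi ho => hP.le_of_odd hP0 (by simp) ho.pos (by omega)
    · exact fun i hi ho => (hQ.le_of_odd hQ0 (by simp) ho.pos (by omega)).trans hQP.le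
  · have hcr : c r = P r := hlow r le_rfl
    have hcp : c (r - 1) = P (r - 1) := hlow _ (by omega)
    have hcq : c (r + 1) = Q (s - 1) := by
      rw [hhigh _ (by omega)]
      congr 1
      omega
    rcases Nat.even_or_odd r with he | ho
    · have hes := hpar.1 he
      have hr1' : Odd (r - 1) := Nat.Even.sub_odd hr1 he odd_one
      have hs1' : Odd (s - 1) := Nat.Even.sub_odd hs1 hes odd_one
      have hleft : ∀ i < 2 * (m + 2), Even i → c i ≤ c r := by
        rw [hcr]
        refine hall (fun z => z ≤ P r) ?_ ?_
        · exact fun i hi hie => hP.le_of_even hP0 hie hi hrk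
        · exact fun i hi hie => hrs ▸ hQ.le_of_even hQ0 hie hi hsk
      have hPodd : ∀ i ≤ r, Odd i → P (r - 1) ≤ P i := fun i hi hio => by
        have : i ≠ r := by rintro rfl; exact Nat.not_even_iff_odd.2 hio he
        exact hP.le_of_odd hP0 hio (by omega) (by omega)
      have hQodd : ∀ i ≤ s, Odd i → Q (s - 1) ≤ Q i := fun i hi hio => by
        have : i ≠ s := by rintro rfl; exact Nat.not_even_iff_odd.2 hio hes
        exact hQ.le_of_odd hQ0 hio (by omega) (by omega)
      rcases le_total (P (r - 1)) (Q (s - 1)) with hle | hle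
      · refine ⟨r, r - 1, by omega, he, hr1', Or.inl (by omega), ?_,
          fun i hi => ⟨hleft i hi, hall' (fun z => c (r - 1) ≤ z) ?_ ?_ i hi⟩⟩
        · rw [hcr, hcp]
          exact hP.lt_of_odd hP0 hr1' (by omega) hrk
        · rwa [hcp]
        · rw [hcp]
          exact fun i hi hio => hle.trans (hQodd i hi hio)
      · refine ⟨r, r + 1, ?_, he, he.add_one, Or.inr rfl, ?_,
          fun i hi => ⟨hleft i hi, hall' (fun z => c (r + 1) ≤ z) ?_ ?_ i hi⟩⟩
        · have := hs1'.pos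
          omega
        · rw [hcr, hcq, hrs]
          exact hQ.lt_of_odd hQ0 hs1' (by omega) hsk
        · rw [hcq]
          exact fun i hi hio => hle.trans (hPodd i hi hio)
        · rwa [hcq]
    · have hos : Odd s := Nat.not_even_iff_odd.1 fun h => Nat.not_even_iff_odd.2 ho (hpar.2 h)
      have hr1' : Even (r - 1) := Nat.Odd.sub_odd ho odd_one
      have hs1' : Even (s - 1) := Nat.Odd.sub_odd hos odd_one
      have hright : ∀ i < 2 * (m + 2), Odd i → c r ≤ c i := by
        rw [hcr]
        refine hall' (fun z => P r ≤ z) ?_ ?_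
        · exact fun i hi hio => hP.le_of_odd hP0 hio hi hrk
        · exact fun i hi hio => hrs ▸ hQ.le_of_odd hQ0 hio hi hsk
      have hPeven : ∀ i ≤ r, Even i → P i ≤ P (r - 1) := fun i hi hie => by
        have : i ≠ r := by rintro rfl; exact Nat.not_even_iff_odd.2 ho hie
        exact hP.le_of_even hP0 hie (by omega) (by omega)
      have hQeven : ∀ i ≤ s, Even i → Q i ≤ Q (s - 1) := fun i hi hie => by
        have : i ≠ s := by rintro rfl; exact Nat.not_even_iff_odd.2 hos hie
        exact hQ.le_of_even hQ0 hie (by omega) (by omega)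
      rcases le_total (Q (s - 1)) (P (r - 1)) with hle | hle
      · refine ⟨r - 1, r, by omega, hr1', ho, Or.inr (by omega), ?_,
          fun i hi => ⟨hall (fun z => z ≤ c (r - 1)) ?_ ?_ i hi, hright i hi⟩⟩
        · rw [hcr, hcp]
          exact hP.lt_of_even hP0 hr1' (by omega) hrk
        · rwa [hcp]
        · rw [hcp]
          exact fun i hi hio => (hQeven i hi hio).trans hle
      · refine ⟨r + 1, r, by omega, ho.add_one, ho, Or.inl rfl, ?_,
          fun i hi => ⟨hall (fun z => z ≤ c (r + 1)) ?_ ?_ i hi, hright i hi⟩⟩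
        · rw [hcr, hcq, hrs]
          exact hQ.lt_of_even hQ0 hs1' (by omega) hsk
        · rw [hcq]
          exact fun i hi hio => (hPeven i hi hio).trans hle
        · rwa [hcq]

theorem exists_hasBorderedCycle_of_lt (hP : IsShrinkingWalk G k P)
    (hQ : IsShrinkingWalk G k Q) (h0 : P 0 = Q 0) (hk : P k = Q k) (hk0 : 0 < k)
    (hP0 : P 0 < P 1) (hQ0 : Q 0 < Q 1) (hne : P 1 ≠ Q 1) :
    ∃ l, 2 ≤ l ∧ l ≤ k ∧ HasBorderedCycle G l := by
  rcases hne.lt_or_gt with h | h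
  · exact hQ.exists_hasBorderedCycle_of_lt_of_lt hP h0.symm hk.symm hk0 hP0 h
  · exact hP.exists_hasBorderedCycle_of_lt_of_lt hQ h0 hk hk0 hQ0 h

/-- Two shrinking walks that leave a common vertex to the same side along different edges and
end at a common vertex create a bordered cycle. -/
theorem exists_hasBorderedCycle (hP : IsShrinkingWalk G k P)
    (hQ : IsShrinkingWalk G k Q) (h0 : P 0 = Q 0) (hk : P k = Q k) (hk0 : 0 < k)
    (hside : (P 0 < P 1 ∧ Q 0 < Q 1) ∨ (P 1 < P 0 ∧ Q 1 < Q 0)) (hne : P 1 ≠ Q 1) :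
    ∃ l, 2 ≤ l ∧ l ≤ k ∧ HasBorderedCycle G l := by
  rcases hside with h | h
  · exact hP.exists_hasBorderedCycle_of_lt hQ h0 hk hk0 h.1 h.2 hne
  · obtain ⟨l, h2, hl, hc⟩ :=
      hP.dual.exists_hasBorderedCycle_of_lt hQ.dual h0 hk hk0 h.1 h.2 hne
    exact ⟨l, h2, hl, hc.of_dual⟩

end IsShrinkingWalk

section Counting

open Finset
open scoped Classical

variable {V : Type*} [LinearOrder V] [Fintype V] (G : SimpleGraph V)

/-- The endpoints of the shrinking walks with `j + 1` edges starting with `x, y`. -/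
noncomputable def shrinkingEnds (j : ℕ) (x y : V) : Finset V :=
  {z | ∃ P, IsShrinkingWalk G (j + 1) P ∧ P 0 = x ∧ P 1 = y ∧ P (j + 1) = z}

/-- The ordered pairs of adjacent vertices starting few shrinking walks with `j + 1` edges. -/
noncomputable def poorDarts (t j : ℕ) : Finset (V × V) :=
  {p | G.Adj p.1 p.2 ∧ #(shrinkingEnds G j p.1 p.2) < t ^ j}

variable {G}

theorem poorDarts_zero (t : ℕ) : poorDarts G t 0 = ∅ := by
  refine filter_eq_empty_iff.2 fun p _ ⟨hadj, hlt⟩ => ?_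
  rw [pow_zero, Nat.lt_one_iff, card_eq_zero] at hlt
  have : p.2 ∈ shrinkingEnds G 0 p.1 p.2 := by
    refine mem_filter.2 ⟨mem_univ _, fun i => if i = 0 then p.1 else p.2, ⟨?_, ?_⟩, ?_⟩
    · intro i hi
      obtain rfl : i = 0 := by omega
      simpa using hadj
    · intro i hi
      omega
    · simp
  simp [hlt] at this

theorem disjoint_shrinkingEnds {k j : ℕ} (hfree : ∀ l, 2 ≤ l → l ≤ k → ¬ HasBorderedCycle G l)
    (hj : j + 1 ≤ k) {x y y' : V} (hside : (x < y ∧ x < y') ∨ (y < x ∧ y' < x)) (hne : y ≠ y') :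
    Disjoint (shrinkingEnds G j x y) (shrinkingEnds G j x y') := by
  refine disjoint_left.2 fun z hz hz' => ?_
  obtain ⟨P, hP, rfl, rfl, hPz⟩ := (mem_filter.1 hz).2
  obtain ⟨Q, hQ, hQ0, rfl, hQz⟩ := (mem_filter.1 hz').2
  obtain ⟨l, h2, hl, hc⟩ := hP.exists_hasBorderedCycle hQ hQ0.symm (hPz.trans hQz.symm) (by omega)
    (by rwa [hQ0]) hne
  exact hfree l h2 (hl.trans hj) hc

theorem mul_card_le_card_shrinkingEnds_succ {k j : ℕ}
    (hfree : ∀ l, 2 ≤ l → l ≤ k → ¬ HasBorderedCycle G l)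
    (hj : j + 1 ≤ k) {x y : V} (hxy : G.Adj x y) (c : ℕ) (W : Finset V)
    (hW : ∀ w ∈ W, StrictlyBetween x w y ∧ c ≤ #(shrinkingEnds G j y w)) :
    #W * c ≤ #(shrinkingEnds G (j + 1) x y) := by
  have hsub : W.biUnion (shrinkingEnds G j y) ⊆ shrinkingEnds G (j + 1) x y := by
    refine biUnion_subset.2 fun w hw z hz => ?_
    obtain ⟨P, hP, rfl, rfl, rfl⟩ := (mem_filter.1 hz).2
    exact mem_filter.2 ⟨mem_univ _, _, hP.cons hxy (hW _ hw).1, rfl, rfl, rfl⟩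
  refine le_trans ?_ (card_le_card hsub)
  rw [card_biUnion]
  · simpa using sum_le_sum fun w hw => (hW w hw).2
  · intro w hw w' hw' hne
    refine disjoint_shrinkingEnds hfree hj ?_ hne
    have h1 := (hW w hw).1
    have h2 := (hW w' hw').1
    unfold StrictlyBetween at h1 h2
    grind

theorem card_poorDarts_succ_le {k t j : ℕ} (hfree : ∀ l, 2 ≤ l → l ≤ k → ¬ HasBorderedCycle G l)
    (hj : j + 1 ≤ k) :
    #(poorDarts G t (j + 1)) ≤ #(poorDarts G t j) + 2 * t * Fintype.card V := by
  have hsub : poorDarts G t (j + 1) ⊆ (poorDarts G t j).image Prod.swap ∪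
      {p ∈ poorDarts G t (j + 1) | p.swap ∉ poorDarts G t j} := by
    intro p hp
    by_cases h : p.swap ∈ poorDarts G t j
    · exact mem_union_left _ (mem_image.2 ⟨_, h, Prod.swap_swap p⟩)
    · exact mem_union_right _ (mem_filter.2 ⟨hp, h⟩)
  refine (card_le_card hsub).trans ((card_union_le _ _).trans (add_le_add card_image_le ?_))
  refine (card_le_mul_card_image (f := Prod.snd) _ (2 * t) fun y _ => ?_).trans
    (Nat.mul_le_mul_left _ (card_le_univ _))
  rw [← card_image_of_injOn (f := Prod.fst) fun p hp q hq hpq => Prod.ext hpq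
    ((mem_filter.1 hp).2.trans (mem_filter.1 hq).2.symm)]
  have hmem : ∀ x ∈ image Prod.fst {p ∈ {p ∈ poorDarts G t (j + 1) | p.swap ∉ poorDarts G t j} |
      p.2 = y}, (x, y) ∈ poorDarts G t (j + 1) ∧ (y, x) ∉ poorDarts G t j := by
    intro x hx
    obtain ⟨p, hp, rfl⟩ := mem_image.1 hx
    obtain rfl := (mem_filter.1 hp).2
    exact mem_filter.1 (mem_filter.1 hp).1
  generalize image Prod.fst (_ : Finset (V × V)) = A at hmem ⊢
  refine card_le_of_forall_card_filter_strictlyBetween _ y t ?_ ?_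
  · exact fun hy => G.loopless.irrefl y (mem_filter.1 (hmem y hy).1).2.1
  · intro x hx
    obtain ⟨hxy, hlt⟩ := (mem_filter.1 (hmem x hx).1).2
    by_contra! hle
    refine hlt.not_ge (le_trans ?_
      (mul_card_le_card_shrinkingEnds_succ hfree hj hxy (t ^ j)
        {w ∈ A | StrictlyBetween x w y} fun w hw => ?_))
    · rw [pow_succ']
      exact Nat.mul_le_mul_right _ hle
    · obtain ⟨hw, hb⟩ := mem_filter.1 hw
      obtain ⟨hw1, hw2⟩ := hmem w hw
      refine ⟨hb, not_lt.1 fun h => hw2 (mem_filter.2 ⟨mem_univ _, ?_, h⟩)⟩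
      exact (mem_filter.1 hw1).2.1.symm

theorem card_poorDarts_le {k t j : ℕ} (hfree : ∀ l, 2 ≤ l → l ≤ k → ¬ HasBorderedCycle G l)
    (hj : j ≤ k) : #(poorDarts G t j) ≤ j * (2 * t * Fintype.card V) := by
  induction j with
  | zero => simp [poorDarts_zero]
  | succ j ih =>
    have := card_poorDarts_succ_le (t := t) hfree hj
    rw [Nat.succ_mul]
    exact this.trans (Nat.add_le_add_right (ih (by omega)) _)

theorem sum_card_shrinkingEnds_le {k j : ℕ} (hfree : ∀ l, 2 ≤ l → l ≤ k → ¬ HasBorderedCycle G l)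
    (hj : j + 1 ≤ k) (x : V) :
    ∑ y with G.Adj x y, #(shrinkingEnds G j x y) ≤ 2 * Fintype.card V := by
  rw [← sum_filter_add_sum_filter_not _ (fun y => x < y), two_mul]
  refine add_le_add ?_ ?_
  · rw [← card_biUnion]
    · exact card_le_univ _
    · intro y hy y' hy' hne
      exact disjoint_shrinkingEnds hfree hj (Or.inl ⟨(mem_filter.1 hy).2, (mem_filter.1 hy').2⟩) hne
  · rw [← card_biUnion]
    · exact card_le_univ _
    · have hlt : ∀ y ∈ ({y ∈ ({y | G.Adj x y} : Finset V) | ¬ x < y} : Finset V), y < x := by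
        intro y hy
        simp only [mem_filter, mem_univ, true_and, not_lt] at hy
        exact lt_of_le_of_ne hy.2 hy.1.ne'
      intro y hy y' hy' hne
      exact disjoint_shrinkingEnds hfree hj (Or.inr ⟨hlt y hy, hlt y' hy'⟩) hne

theorem two_mul_card_edgeSet_le {j : ℕ} (t : ℕ)
    (hfree : ∀ l, 2 ≤ l → l ≤ j + 1 → ¬ HasBorderedCycle G l) :
    2 * Nat.card G.edgeSet * t ^ j ≤
      2 * Fintype.card V ^ 2 + j * (2 * t * Fintype.card V) * t ^ j := by
  have hdarts : #{p : V × V | G.Adj p.1 p.2} = 2 * Nat.card G.edgeSet := by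
    rw [Nat.card_eq_fintype_card, ← SimpleGraph.edgeFinset_card,
      ← SimpleGraph.sum_degrees_eq_twice_card_edges, card_filter, Fintype.sum_prod_type]
    refine sum_congr rfl fun x _ => ?_
    rw [← card_filter, ← SimpleGraph.card_neighborFinset_eq_degree,
      SimpleGraph.neighborFinset_eq_filter]
  have hrich : #{p : V × V | G.Adj p.1 p.2} ≤
      #{p ∈ ({p : V × V | G.Adj p.1 p.2} : Finset _) | t ^ j ≤ #(shrinkingEnds G j p.1 p.2)} +
        #(poorDarts G t j) := by
    rw [← card_filter_add_card_filter_not (fun p : V × V => t ^ j ≤ #(shrinkingEnds G j p.1 p.2))]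
    refine Nat.add_le_add_left (card_le_card fun p hp => ?_) _
    simpa [poorDarts] using hp
  have hsum : #{p ∈ ({p : V × V | G.Adj p.1 p.2} : Finset _) |
      t ^ j ≤ #(shrinkingEnds G j p.1 p.2)} * t ^ j ≤ 2 * Fintype.card V ^ 2 := by
    calc _ ≤ ∑ p ∈ ({p : V × V | G.Adj p.1 p.2} : Finset _) with
          t ^ j ≤ #(shrinkingEnds G j p.1 p.2), #(shrinkingEnds G j p.1 p.2) := by
          rw [← smul_eq_mul]
          exact card_nsmul_le_sum _ _ _ fun p hp => (mem_filter.1 hp).2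
      _ ≤ ∑ p : V × V with G.Adj p.1 p.2, #(shrinkingEnds G j p.1 p.2) :=
          sum_le_sum_of_subset (filter_subset _ _)
      _ = ∑ x, ∑ y with G.Adj x y, #(shrinkingEnds G j x y) := by
          rw [sum_filter, Fintype.sum_prod_type]
          exact sum_congr rfl fun x _ => (sum_filter _ _).symm
      _ ≤ ∑ _x : V, 2 * Fintype.card V :=
          sum_le_sum fun x _ => sum_card_shrinkingEnds_le hfree le_rfl x
      _ = 2 * Fintype.card V ^ 2 := by
          rw [sum_const, card_univ, smul_eq_mul]
          ring
  rw [← hdarts]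
  refine (Nat.mul_le_mul_right _ hrich).trans ?_
  rw [add_mul]
  exact add_le_add hsum (Nat.mul_le_mul_right _ (card_poorDarts_le hfree (by omega)))

end Counting

/-- **Upper bound.** Let `k ≥ 2`. Every ordered graph on `n ≥ 1` vertices that contains no
bordered cycle of length `2 * l` for any `2 ≤ l ≤ k` has fewer than `3 * k * n ^ (1 + 1/k)`
edges. -/
theorem bordered_girth_upper (k : ℕ) (hk : 2 ≤ k) (n : ℕ) (hn : 0 < n)
    (G : SimpleGraph (Fin n))
    (hfree : ∀ l, 2 ≤ l → l ≤ k → ¬ HasBorderedCycle G l) :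
    (Nat.card G.edgeSet : ℝ) < 3 * (k : ℝ) * (n : ℝ) ^ (1 + 1 / (k : ℝ)) := by
  obtain ⟨j, rfl⟩ : ∃ j, k = j + 1 := ⟨k - 1, by omega⟩
  have hn1 : (1 : ℝ) ≤ n := by exact_mod_cast hn
  have hn0 : (0 : ℝ) < n := by linarith
  rw [Real.rpow_add hn0, Real.rpow_one]
  have hT1 : (1 : ℝ) ≤ (n : ℝ) ^ (1 / ((j + 1 : ℕ) : ℝ)) := Real.one_le_rpow hn1 (by positivity)
  have hTn : ((n : ℝ) ^ (1 / ((j + 1 : ℕ) : ℝ))) ^ (j + 1) = n := by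
    rw [one_div]
    exact Real.rpow_inv_natCast_pow hn0.le (by omega)
  generalize (n : ℝ) ^ (1 / ((j + 1 : ℕ) : ℝ)) = T at hT1 hTn ⊢
  have hT0 : 0 < T := by linarith
  have hle := Nat.le_ceil T
  have hlt := Nat.ceil_lt_add_one hT0.le
  have hcount := two_mul_card_edgeSet_le ⌈T⌉₊ hfree
  rw [Fintype.card_fin] at hcount
  have hcount' : 2 * (Nat.card G.edgeSet : ℝ) * (⌈T⌉₊ : ℝ) ^ j ≤
      2 * (n : ℝ) ^ 2 + j * (2 * ⌈T⌉₊ * n) * (⌈T⌉₊ : ℝ) ^ j := by exact_mod_cast hcount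
  generalize (Nat.card G.edgeSet : ℝ) = E at hcount' ⊢
  generalize (⌈T⌉₊ : ℝ) = t at *
  have ht0 : 0 < t := by linarith
  have hpow : T ^ j ≤ t ^ j := pow_le_pow_left₀ hT0.le hle j
  have hn2 : (n : ℝ) ^ 2 ≤ n * T * t ^ j := by
    calc (n : ℝ) ^ 2 = n * T * T ^ j := by
          rw [mul_assoc, ← pow_succ', hTn, sq]
      _ ≤ n * T * t ^ j := by gcongr
  have hE : 2 * E ≤ 2 * (n * T) + j * (2 * t * n) := by
    refine le_of_mul_le_mul_right ?_ (pow_pos ht0 j)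
    linarith
  have hjt : (j : ℝ) * (t * n) ≤ j * (2 * T * n) := by
    gcongr
    linarith
  have hpos : 0 < n * T := by positivity
  have hj0 : 0 ≤ j * (n * T) := by positivity
  push_cast
  nlinarith
end

section
/- Let k ≥ 2 and n ≥ 1 be integers, and let S ⊆ {1, 2, …, n} be a B_k-set. Then there exists an ordered graph on 4n vertices with exactly n·|S| edges that contains no bordered cycle of length 2l for any 2 ≤ l ≤ k. (Concretely, one may take the ordered bipartite graph with parts U = {1,…,2n} and V = {1,…,2n}, U preceding V, in which vertex i of U is joined to vertex j of V if and only if 1 ≤ i ≤ n and i − j + n ∈ S.) -/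
/-- `S` is a `B_k`-set: whenever two `k`-sums of elements of `S` agree, the corresponding
multisets of summands agree. -/
def IsBkSet (k : ℕ) (S : Set ℤ) : Prop :=
  ∀ x y : Fin k → ℤ, (∀ i, x i ∈ S) → (∀ i, y i ∈ S) →
    ∑ i, x i = ∑ i, y i →
    Multiset.map x Finset.univ.val = Multiset.map y Finset.univ.val

/-- A `B_k`-set is a `B_l`-set for every `l ≤ k`. -/
theorem IsBkSet.mono {k l : ℕ} {S : Set ℤ} (hS : IsBkSet k S) (hlk : l ≤ k) : IsBkSet l S := by
  intro x y hx hy hxy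
  obtain ⟨d, rfl⟩ := Nat.exists_eq_add_of_le hlk
  rcases Nat.eq_zero_or_pos l with rfl | hl
  · rw [Subsingleton.elim x y]
  set c : Fin d → ℤ := fun _ => x ⟨0, hl⟩
  have append_mem : ∀ z : Fin l → ℤ, (∀ i, z i ∈ S) → ∀ i, Fin.append z c i ∈ S := by
    intro z hz i
    induction i using Fin.addCases with
    | left i => simpa using hz i
    | right i => simpa using hx _
  have h := hS (Fin.append x c) (Fin.append y c) (append_mem x hx) (append_mem y hy)
    (by simp [Fin.sum_univ_add, hxy])
  simp only [Fin.univ_val_map, List.ofFn_fin_append, ← Multiset.coe_add] at h ⊢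
  exact add_right_cancel h

/-- The ordered graph on `4 * n` vertices in which each `p < n` is joined to the vertices
`3 * n + p - s` with `s ∈ S`. -/
def differenceGraph (n : ℕ) (S : Finset ℤ) (hS : ↑S ⊆ Set.Icc (1 : ℤ) (n : ℤ)) :
    SimpleGraph (Fin (4 * n)) where
  Adj p q := ((p : ℕ) < n ∧ 3 * (n : ℤ) + (p : ℕ) - (q : ℕ) ∈ S) ∨
    ((q : ℕ) < n ∧ 3 * (n : ℤ) + (q : ℕ) - (p : ℕ) ∈ S)
  symm := ⟨fun _ _ h => h.symm⟩
  loopless := ⟨fun p h => by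
    have h' : (p : ℕ) < n ∧ 3 * (n : ℤ) + (p : ℕ) - (p : ℕ) ∈ S := by simpa using h
    have := (hS h'.2).2
    omega⟩

section differenceGraph

variable {n : ℕ} {S : Finset ℤ} {hS : ↑S ⊆ Set.Icc (1 : ℤ) (n : ℤ)}

theorem differenceGraph_adj_of_lt {p q : Fin (4 * n)} (hpq : p < q) :
    (differenceGraph n S hS).Adj p q ↔
      (p : ℕ) < n ∧ 3 * (n : ℤ) + (p : ℕ) - (q : ℕ) ∈ S := by
  refine ⟨fun h => h.resolve_right fun h' => ?_, Or.inl⟩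
  have := (hS h'.2).2
  have : (p : ℕ) < q := hpq
  omega

theorem card_edgeSet_differenceGraph :
    Nat.card (differenceGraph n S hS).edgeSet = n * S.card := by
  have bounds (s : S) : 1 ≤ (s : ℤ) ∧ (s : ℤ) ≤ n := hS s.2
  let f : Fin n × S → Sym2 (Fin (4 * n)) := fun e =>
    s(⟨e.1, by omega⟩, ⟨(3 * n + (e.1 : ℕ) - (e.2 : ℤ)).toNat, by
      have := bounds e.2; omega⟩)
  have hf : Function.Injective f := by
    rintro ⟨p, s⟩ ⟨q, t⟩ h
    have hs := bounds s
    have ht := bounds t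
    simp only [f, Sym2.eq_iff, Fin.mk.injEq] at h
    ext <;> simp only <;> omega
  have hrange : (differenceGraph n S hS).edgeSet = Set.range f := by
    ext e
    induction e using Sym2.ind with | _ p q
    rw [SimpleGraph.mem_edgeSet]
    have adj_mem {p q : Fin (4 * n)} (hp : (p : ℕ) < n)
        (hs : 3 * (n : ℤ) + (p : ℕ) - (q : ℕ) ∈ S) : s(p, q) ∈ Set.range f := by
      refine ⟨(⟨p, hp⟩, ⟨_, hs⟩), ?_⟩
      simp only [f]
      congr 2
      omega
    constructor
    · rintro (⟨hp, hs⟩ | ⟨hq, hs⟩)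
      · exact adj_mem hp hs
      · rw [Sym2.eq_swap]
        exact adj_mem hq hs
    · rintro ⟨⟨r, s⟩, h⟩
      have hs := bounds s
      rw [← SimpleGraph.mem_edgeSet, ← h, SimpleGraph.mem_edgeSet]
      refine Or.inl ⟨r.2, ?_⟩
      convert s.2 using 1
      simp only
      omega
  rw [hrange, Nat.card_range_of_injective hf]
  simp

theorem not_hasBorderedCycle_differenceGraph {l : ℕ} (hSl : IsBkSet l ↑S) :
    ¬ HasBorderedCycle (differenceGraph n S hS) l := by
  rintro ⟨_, _, m, rfl, u, v, a, b, hu, hv, huv, h₁, h₂, houter, -⟩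
  have hlt (i j) : u i < v j :=
    (hu.monotone (Fin.le_last i)).trans_lt (huv.trans_le (hv.monotone (Fin.zero_le j)))
  let d (i j : Fin (m + 2)) : ℤ := 3 * (n : ℤ) + (u i : ℕ) - (v j : ℕ)
  -- The outer border is the unique edge minimizing `d`, so it occurs only once on the cycle.
  have d_eq_border {i j} (h : d i j = d 0 (Fin.last _)) : i = 0 ∧ j = Fin.last _ := by
    have hi : (u 0 : ℕ) ≤ u i := hu.monotone (Fin.zero_le i)
    have hj : (v j : ℕ) ≤ v (Fin.last _) := hv.monotone (Fin.le_last j)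
    simp only [d] at h
    exact ⟨hu.injective (Fin.ext (by omega)), hv.injective (Fin.ext (by omega))⟩
  have hsum : ∑ s, d (a s) (b s) = ∑ s, d (a (s + 1)) (b s) := by
    simp only [d, Finset.sum_sub_distrib, Finset.sum_add_distrib]
    rw [← Equiv.sum_comp (Equiv.addRight (1 : Fin (m + 2))) fun s => ((u (a s) : ℕ) : ℤ)]
    rfl
  have hmul := hSl (fun s => d (a s) (b s)) (fun s => d (a (s + 1)) (b s))
    (fun s => ((differenceGraph_adj_of_lt (hlt _ _)).1 (h₁ s)).2)
    (fun s => ((differenceGraph_adj_of_lt (hlt _ _)).1 (h₂ s)).2) hsum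
  have hmem (w) : (∃ s, d (a s) (b s) = w) ↔ ∃ s, d (a (s + 1)) (b s) = w := by
    have h := congrArg (w ∈ ·) hmul
    simpa only [Multiset.mem_map, Finset.mem_val, Finset.mem_univ, true_and, eq_iff_iff] using h
  have succ_ne (s : Fin (m + 2)) : s + 1 ≠ s := by simp
  obtain ⟨s, ⟨has, hbs⟩ | ⟨has, hbs⟩⟩ := houter
  · obtain ⟨t, ht⟩ := (hmem _).1 ⟨s, rfl⟩
    obtain ⟨hat, hbt⟩ := d_eq_border (by rw [ht, has, hbs])
    obtain rfl := b.injective (hbt.trans hbs.symm)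
    exact succ_ne _ (a.injective (hat.trans has.symm))
  · obtain ⟨t, ht⟩ := (hmem _).2 ⟨s, rfl⟩
    obtain ⟨hat, hbt⟩ := d_eq_border (by rw [ht, has, hbs])
    obtain rfl := b.injective (hbt.trans hbs.symm)
    exact succ_ne _ (a.injective (has.trans hat.symm))

end differenceGraph

/-- **Lower bound construction.** Let `k ≥ 2`, `n ≥ 1`, and let `S ⊆ {1, …, n}` be a
`B_k`-set.  Then there is an ordered graph on `4 * n` vertices with exactly `n * |S|` edges
containing no bordered cycle of length `2 * l` for any `2 ≤ l ≤ k`. -/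
theorem bordered_girth_lower_construction (k : ℕ) (hk : 2 ≤ k) (n : ℕ) (hn : 1 ≤ n)
    (S : Finset ℤ) (hS : ↑S ⊆ Set.Icc (1 : ℤ) (n : ℤ)) (hSk : IsBkSet k ↑S) :
    ∃ G : SimpleGraph (Fin (4 * n)),
      Nat.card G.edgeSet = n * S.card ∧
      ∀ l, 2 ≤ l → l ≤ k → ¬ HasBorderedCycle G l := by
  exact ⟨differenceGraph n S hS, card_edgeSet_differenceGraph,
    fun l _ hlk => not_hasBorderedCycle_differenceGraph (hSk.mono hlk)⟩
end

section
/- Every ordered graph on n vertices that contains no bordered cycle of length 6 has at most 18·n^{4/3} edges. -/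
theorem eq_or_eq_or_eq_of_not_lt_lt {V : Type*} [LinearOrder V] {P : V → Prop}
    (hP : ∀ a b c, P a → P b → P c → a < b → ¬ b < c) {a b c : V}
    (ha : P a) (hb : P b) (hc : P c) : a = b ∨ a = c ∨ b = c := by
  by_contra! h
  rcases lt_or_gt_of_ne h.1 with hab | hab <;> rcases lt_or_gt_of_ne h.2.1 with hac | hac <;>
    rcases lt_or_gt_of_ne h.2.2 with hbc | hbc <;> grind

open Finset in
/-- If every element of `T` has at most one larger `B`-successor in `T`, and every element has
fewer than `t` smaller elements that are not `B`-related to it, then `T` is small. -/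
theorem card_le_of_functional_of_few_unrelated {V : Type*} [LinearOrder V] (T : Finset V)
    (B : V → V → Prop) [DecidableRel B] (t : ℕ)
    (hB : ∀ a ∈ T, ∀ b ∈ T, ∀ c ∈ T, a < b → a < c → B a b → B a c → b = c)
    (ht : ∀ b ∈ T, #{a ∈ T | a < b ∧ ¬ B a b} < t) :
    #T ≤ 2 * t + 1 := by
  have h_split : #T.offDiag ≤
      #{x ∈ T ×ˢ T | x.1 < x.2} + #{x ∈ T ×ˢ T | x.2 < x.1} := by
    refine (card_le_card fun x hx => ?_).trans (card_union_le _ _)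
    simp only [mem_offDiag, mem_union, mem_filter, mem_product] at hx ⊢
    rcases lt_or_gt_of_ne hx.2.2 with h | h
    · exact Or.inl ⟨⟨hx.1, hx.2.1⟩, h⟩
    · exact Or.inr ⟨⟨hx.1, hx.2.1⟩, h⟩
  have h_swap : #{x ∈ T ×ˢ T | x.2 < x.1} ≤ #{x ∈ T ×ˢ T | x.1 < x.2} := by
    refine card_le_card_of_injOn Prod.swap (fun x hx => ?_) Prod.swap_injective.injOn
    simp only [coe_filter, mem_product, Set.mem_ofPred_eq, Prod.fst_swap, Prod.snd_swap] at hx ⊢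
    tauto
  have h_lt : #{x ∈ T ×ˢ T | x.1 < x.2} ≤
      #{x ∈ T ×ˢ T | x.1 < x.2 ∧ B x.1 x.2} + #{x ∈ T ×ˢ T | x.1 < x.2 ∧ ¬ B x.1 x.2} := by
    refine (card_le_card fun x hx => ?_).trans (card_union_le _ _)
    simp only [mem_union, mem_filter] at hx ⊢
    tauto
  have h_related : #{x ∈ T ×ˢ T | x.1 < x.2 ∧ B x.1 x.2} ≤ #T := by
    refine card_le_card_of_injOn Prod.fst (fun x hx => ?_) ?_
    · simp only [coe_filter, mem_product, Set.mem_ofPred_eq] at hx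
      exact hx.1.1
    · rintro ⟨a, b⟩ hx ⟨a', c⟩ hy h
      simp only [coe_filter, mem_product, Set.mem_ofPred_eq] at hx hy h
      subst h
      rw [hB a hx.1.1 b hx.1.2 c hy.1.2 hx.2.1 hy.2.1 hx.2.2 hy.2.2]
  have h_unrelated : #{x ∈ T ×ˢ T | x.1 < x.2 ∧ ¬ B x.1 x.2} ≤ (t - 1) * #T := by
    refine card_le_mul_card_image_of_maps_to (f := Prod.snd) (fun x hx => ?_) _ fun b hb => ?_
    · exact (mem_product.1 (mem_filter.1 hx).1).2
    · refine le_trans ?_ (Nat.le_sub_one_of_lt (ht b hb))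
      refine card_le_card_of_injOn Prod.fst (fun x hx => ?_) ?_
      · simp only [coe_filter, mem_filter, mem_product, Set.mem_ofPred_eq] at hx ⊢
        obtain ⟨⟨⟨h₁, -⟩, h₂⟩, rfl⟩ := hx
        exact ⟨h₁, h₂⟩
      · intro x hx y hy h
        simp only [coe_filter, mem_filter, Set.mem_ofPred_eq] at hx hy
        exact Prod.ext h (hx.2.trans hy.2.symm)
  rw [offDiag_card] at h_split
  rcases T.eq_empty_or_nonempty with rfl | ⟨b, hb⟩
  · simp
  have h_pos : 0 < #T := card_pos.2 ⟨b, hb⟩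
  have ht_pos : 0 < t := (Nat.zero_le _).trans_lt (ht b hb)
  obtain ⟨k, rfl⟩ : ∃ k, t = k + 1 := ⟨t - 1, by omega⟩
  rw [Nat.add_sub_cancel] at h_unrelated
  have h_sq : #T * #T ≤ #T * (2 * k + 3) := by
    have h := Nat.le_add_of_sub_le h_split
    nlinarith
  have := Nat.le_of_mul_le_mul_left h_sq h_pos
  omega

namespace SimpleGraph

section Ordered

variable {V : Type*} [LinearOrder V] {G : SimpleGraph V}

theorem hasBorderedCycle_three {u q q' v p p' : V} (huq : u < q) (huq' : u < q')
    (hqv : q < v) (hq'v : q' < v) (hvp : v < p) (hvp' : v < p') (hq : q ≠ q') (hp : p ≠ p')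
    (up : G.Adj u p) (up' : G.Adj u p') (qp : G.Adj q p) (qp' : G.Adj q' p')
    (qv : G.Adj q v) (qv' : G.Adj q' v) : HasBorderedCycle G 3 := by
  wlog hlt : q < q' generalizing q q' p p'
  · exact this huq' huq hq'v hqv hvp' hvp hq.symm hp.symm up' up qp' qp qv' qv
      (lt_of_le_of_ne (not_lt.1 hlt) hq.symm)
  have hu : StrictMono ![u, q, q'] := by
    rw [Fin.strictMono_iff_lt_succ]
    intro i
    fin_cases i
    · exact huq
    · exact hlt
  rcases lt_or_gt_of_ne hp with h | h
  · have hv : StrictMono ![v, p, p'] := by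
      rw [Fin.strictMono_iff_lt_succ]
      intro i
      fin_cases i
      · exact hvp
      · exact h
    refine ⟨_, _, 1, rfl, ![u, q, q'], ![v, p, p'], 1, Equiv.swap 0 1, hu, hv, hq'v,
      ?_, ?_, ⟨2, by decide⟩, ⟨1, by decide⟩, rfl, rfl⟩
    · intro s
      fin_cases s
      exacts [up, qv, qp']
    · intro s
      fin_cases s
      exacts [qp, qv', up']
  · have hv : StrictMono ![v, p', p] := by
      rw [Fin.strictMono_iff_lt_succ]
      intro i
      fin_cases i
      · exact hvp'
      · exact h
    refine ⟨_, _, 1, rfl, ![u, q, q'], ![v, p', p], 1, (finRotate 3).symm, hu, hv, hq'v,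
      ?_, ?_, ⟨0, by decide⟩, ⟨1, by decide⟩, rfl, rfl⟩
    · intro s
      fin_cases s
      exacts [up, qv, qp']
    · intro s
      fin_cases s
      exacts [qp, qv', up']

/-- The vertices `a` and `b` have two common neighbours beyond `c`. -/
def OuterBlocked (G : SimpleGraph V) (c a b : V) : Prop :=
  ∃ w₁ w₂, c < w₁ ∧ w₁ < w₂ ∧ G.Adj a w₁ ∧ G.Adj a w₂ ∧ G.Adj b w₁ ∧ G.Adj b w₂

/-- The vertices `a` and `b` have two common neighbours between `c` and `a`. -/
def InnerBlocked (G : SimpleGraph V) (c a b : V) : Prop :=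
  ∃ w₁ w₂, c < w₁ ∧ w₁ < w₂ ∧ w₂ < a ∧
    G.Adj w₁ a ∧ G.Adj w₂ a ∧ G.Adj w₁ b ∧ G.Adj w₂ b

theorem OuterBlocked.unique (hfree : ¬ HasBorderedCycle G 3) {c a b b' : V}
    (hab : a < b) (hab' : a < b') (hbc : b < c) (hbc' : b' < c)
    (hb : G.Adj b c) (hb' : G.Adj b' c)
    (h : G.OuterBlocked c a b) (h' : G.OuterBlocked c a b') : b = b' := by
  by_contra hne
  obtain ⟨w, -, hw, -, haw, -, hbw, -⟩ := h
  obtain ⟨z₁, z₂, hz₁, hz, ha₁, ha₂, hb₁, hb₂⟩ := h'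
  by_cases hwz : w = z₁
  · exact hfree (hasBorderedCycle_three hab hab' hbc hbc' hw (hz₁.trans hz) hne
      (hwz ▸ hz.ne) haw ha₂ hbw hb₂ hb hb')
  · exact hfree (hasBorderedCycle_three hab hab' hbc hbc' hw hz₁ hne hwz haw ha₁ hbw hb₁ hb hb')

theorem InnerBlocked.unique (hfree : ¬ HasBorderedCycle G 3) {c a b b' : V}
    (hab : a < b) (hab' : a < b') (hb : G.Adj c b) (hb' : G.Adj c b')
    (h : G.InnerBlocked c a b) (h' : G.InnerBlocked c a b') : b = b' := by
  by_contra hne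
  obtain ⟨w, w', hw, hww', hw'a, haw, -, hbw, -⟩ := h
  obtain ⟨z₁, z₂, hz₁, hz, hza, ha₁, ha₂, hb₁, hb₂⟩ := h'
  by_cases hwz : w = z₁
  · exact hfree (hasBorderedCycle_three hw (hz₁.trans hz) (hww'.trans hw'a) hza hab hab'
      (hwz ▸ hz.ne) hne hb hb' hbw hb₂ haw ha₂)
  · exact hfree (hasBorderedCycle_three hw hz₁ (hww'.trans hw'a) (hz.trans hza) hab hab'
      hwz hne hb hb' hbw hb₁ haw ha₁)

/-- The path `u, y, x, v` consists of three nested edges, and neither of its two halves is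
blocked. -/
structure IsNestedPath (G : SimpleGraph V) (u x v y : V) : Prop where
  left_lt : u < x
  mid_lt : x < v
  right_lt : v < y
  outer : G.Adj u y
  mid : G.Adj x y
  inner : G.Adj x v
  not_outerBlocked : ¬ G.OuterBlocked y u x
  not_innerBlocked : ¬ G.InnerBlocked x v y

theorem IsNestedPath.eq_or_eq (hfree : ¬ HasBorderedCycle G 3) {u v x x' y y' : V}
    (h : G.IsNestedPath u x v y) (h' : G.IsNestedPath u x' v y') : x = x' ∨ y = y' := by
  by_contra! hne
  exact hfree (hasBorderedCycle_three h.left_lt h'.left_lt h.mid_lt h'.mid_lt h.right_lt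
    h'.right_lt hne.1 hne.2 h.outer h'.outer h.mid h'.mid h.inner h'.inner)

theorem IsNestedPath.not_lt_lt_right {u v x y₁ y₂ y₃ : V} (h₁ : G.IsNestedPath u x v y₁)
    (h₂ : G.IsNestedPath u x v y₂) (h₃ : G.IsNestedPath u x v y₃) (h₁₂ : y₁ < y₂) :
    ¬ y₂ < y₃ := fun h₂₃ =>
  h₁.not_outerBlocked ⟨y₂, y₃, h₁₂, h₂₃, h₂.outer, h₃.outer, h₂.mid, h₃.mid⟩

theorem IsNestedPath.not_lt_lt_left {u v x₁ x₂ x₃ y : V} (h₁ : G.IsNestedPath u x₁ v y)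
    (h₂ : G.IsNestedPath u x₂ v y) (h₃ : G.IsNestedPath u x₃ v y) (h₁₂ : x₁ < x₂) :
    ¬ x₂ < x₃ := fun h₂₃ =>
  h₁.not_innerBlocked ⟨x₂, x₃, h₁₂, h₂₃, h₃.mid_lt, h₂.inner, h₃.inner, h₂.mid, h₃.mid⟩

theorem IsNestedPath.not_three_right {u v x y₁ y₂ y₃ : V} (h₁ : G.IsNestedPath u x v y₁)
    (h₂ : G.IsNestedPath u x v y₂) (h₃ : G.IsNestedPath u x v y₃) :
    y₁ = y₂ ∨ y₁ = y₃ ∨ y₂ = y₃ :=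
  eq_or_eq_or_eq_of_not_lt_lt (P := fun y => G.IsNestedPath u x v y)
    (fun _ _ _ h h' h'' => h.not_lt_lt_right h' h'') h₁ h₂ h₃

theorem IsNestedPath.not_three_left {u v x₁ x₂ x₃ y : V} (h₁ : G.IsNestedPath u x₁ v y)
    (h₂ : G.IsNestedPath u x₂ v y) (h₃ : G.IsNestedPath u x₃ v y) :
    x₁ = x₂ ∨ x₁ = x₃ ∨ x₂ = x₃ :=
  eq_or_eq_or_eq_of_not_lt_lt (P := fun x => G.IsNestedPath u x v y)
    (fun _ _ _ h h' h'' => h.not_lt_lt_left h' h'') h₁ h₂ h₃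

theorem IsNestedPath.not_three (hfree : ¬ HasBorderedCycle G 3) {u v x₁ x₂ x₃ y₁ y₂ y₃ : V}
    (h₁ : G.IsNestedPath u x₁ v y₁) (h₂ : G.IsNestedPath u x₂ v y₂)
    (h₃ : G.IsNestedPath u x₃ v y₃) :
    (x₁, y₁) = (x₂, y₂) ∨ (x₁, y₁) = (x₃, y₃) ∨ (x₂, y₂) = (x₃, y₃) := by
  simp only [Prod.mk.injEq]
  rcases h₁.eq_or_eq hfree h₂ with rfl | rfl <;> rcases h₁.eq_or_eq hfree h₃ with rfl | rfl
  · have := h₁.not_three_right h₂ h₃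
    tauto
  · rcases h₂.eq_or_eq hfree h₃ with rfl | rfl <;> tauto
  · rcases h₂.eq_or_eq hfree h₃ with rfl | rfl <;> tauto
  · have := h₁.not_three_left h₂ h₃
    tauto

end Ordered

section Counting

open Finset
open scoped Classical

variable {V : Type*} [LinearOrder V] [Fintype V] {G : SimpleGraph V}

/-- The edges of `G`, as increasing pairs. -/
noncomputable def orderedEdges (G : SimpleGraph V) : Finset (V × V) :=
  {e | e.1 < e.2 ∧ G.Adj e.1 e.2}

/-- The unblocked extensions of the edge `e` to a surrounding edge with the same right end. -/
noncomputable def outerSteps (G : SimpleGraph V) (e : V × V) : Finset V :=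
  {u | u < e.1 ∧ G.Adj u e.2 ∧ ¬ G.OuterBlocked e.2 u e.1}

/-- The unblocked extensions of the edge `e` to a nested edge with the same left end. -/
noncomputable def innerSteps (G : SimpleGraph V) (e : V × V) : Finset V :=
  {v | e.1 < v ∧ v < e.2 ∧ G.Adj e.1 v ∧ ¬ G.InnerBlocked e.1 v e.2}

theorem card_edgeSet_eq_card_orderedEdges : Nat.card G.edgeSet = #G.orderedEdges := by
  rw [Nat.card_eq_fintype_card, ← edgeFinset_card]
  symm
  refine card_bij (fun e _ => s(e.1, e.2)) ?_ ?_ ?_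
  · intro e he
    simpa [orderedEdges] using (mem_filter.1 he).2.2
  · rintro ⟨a, b⟩ he ⟨c, d⟩ hf h
    simp only [orderedEdges, mem_filter, mem_univ, true_and] at he hf
    rcases Sym2.eq_iff.1 h with ⟨rfl, rfl⟩ | ⟨rfl, rfl⟩
    · rfl
    · exact absurd he.1 hf.1.not_gt
  · intro e
    induction e with
    | _ a b =>
      intro he
      rw [mem_edgeFinset, mem_edgeSet] at he
      rcases lt_or_gt_of_ne he.ne with h | h
      · exact ⟨(a, b), by simp [orderedEdges, h, he], rfl⟩
      · exact ⟨(b, a), by simp [orderedEdges, h, he.symm], Sym2.eq_swap⟩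

theorem card_filter_outerSteps_lt (hfree : ¬ HasBorderedCycle G 3) (t : ℕ) :
    #{e ∈ G.orderedEdges | #(G.outerSteps e) < t} ≤ (2 * t + 1) * Fintype.card V := by
  refine card_le_mul_card_image_of_maps_to (f := Prod.snd) (t := univ) (fun _ _ => mem_univ _) _
    fun c _ => ?_
  have h_small := card_le_of_functional_of_few_unrelated
    {b : V | b < c ∧ G.Adj b c ∧ #(G.outerSteps (b, c)) < t} (G.OuterBlocked c) t ?_ ?_
  · refine le_trans (card_le_card_of_injOn Prod.fst (fun x hx => ?_) ?_) h_small
    · obtain ⟨a, b⟩ := x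
      simp only [orderedEdges, coe_filter, mem_filter, mem_univ, true_and,
        Set.mem_ofPred_eq] at hx ⊢
      obtain ⟨⟨⟨h₁, h₂⟩, h₃⟩, rfl⟩ := hx
      exact ⟨h₁, h₂, h₃⟩
    · intro x hx y hy h
      exact Prod.ext h ((mem_filter.1 hx).2.trans (mem_filter.1 hy).2.symm)
  · intro a ha b hb b' hb' hab hab' h h'
    simp only [mem_filter, mem_univ, true_and] at hb hb'
    exact h.unique hfree hab hab' hb.1 hb'.1 hb.2.1 hb'.2.1 h'
  · intro b hb
    simp only [mem_filter, mem_univ, true_and] at hb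
    refine (card_le_card fun a ha => ?_).trans_lt hb.2.2
    simp only [outerSteps, mem_filter, mem_univ, true_and] at ha ⊢
    exact ⟨ha.2.1, ha.1.2.1, ha.2.2⟩

theorem card_filter_innerSteps_lt (hfree : ¬ HasBorderedCycle G 3) (t : ℕ) :
    #{e ∈ G.orderedEdges | #(G.innerSteps e) < t} ≤ (2 * t + 1) * Fintype.card V := by
  refine card_le_mul_card_image_of_maps_to (f := Prod.fst) (t := univ) (fun _ _ => mem_univ _) _
    fun c _ => ?_
  have h_small := card_le_of_functional_of_few_unrelated
    {b : V | c < b ∧ G.Adj c b ∧ #(G.innerSteps (c, b)) < t} (G.InnerBlocked c) t ?_ ?_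
  · refine le_trans (card_le_card_of_injOn Prod.snd (fun x hx => ?_) ?_) h_small
    · obtain ⟨a, b⟩ := x
      simp only [orderedEdges, coe_filter, mem_filter, mem_univ, true_and,
        Set.mem_ofPred_eq] at hx ⊢
      obtain ⟨⟨⟨h₁, h₂⟩, h₃⟩, rfl⟩ := hx
      exact ⟨h₁, h₂, h₃⟩
    · intro x hx y hy h
      exact Prod.ext ((mem_filter.1 hx).2.trans (mem_filter.1 hy).2.symm) h
  · intro a ha b hb b' hb' hab hab' h h'
    simp only [mem_filter, mem_univ, true_and] at hb hb'
    exact h.unique hfree hab hab' hb.2.1 hb'.2.1 h'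
  · intro b hb
    simp only [mem_filter, mem_univ, true_and] at hb
    refine (card_le_card fun a ha => ?_).trans_lt hb.2.2
    simp only [innerSteps, mem_filter, mem_univ, true_and] at ha ⊢
    exact ⟨ha.1.1, ha.2.1, ha.1.2.1, ha.2.2⟩

theorem sum_card_outerSteps_mul_card_innerSteps_le (hfree : ¬ HasBorderedCycle G 3) :
    ∑ e ∈ G.orderedEdges, #(G.outerSteps e) * #(G.innerSteps e) ≤ 2 * Fintype.card V ^ 2 := by
  have h_path : ∀ x ∈ G.orderedEdges.sigma fun e => G.outerSteps e ×ˢ G.innerSteps e,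
      G.IsNestedPath x.2.1 x.1.1 x.2.2 x.1.2 := by
    rintro ⟨⟨x, y⟩, u, v⟩ h
    simp only [mem_sigma, orderedEdges, outerSteps, innerSteps, mem_product, mem_filter,
      mem_univ, true_and] at h
    obtain ⟨⟨-, h₁⟩, ⟨h₂, h₃, h₄⟩, h₅, h₆, h₇, h₈⟩ := h
    exact ⟨h₂, h₅, h₆, h₃, h₁, h₇, h₄, h₈⟩
  calc ∑ e ∈ G.orderedEdges, #(G.outerSteps e) * #(G.innerSteps e)
      = #(G.orderedEdges.sigma fun e => G.outerSteps e ×ˢ G.innerSteps e) := by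
        simp only [card_sigma, card_product]
    _ ≤ 2 * #(univ : Finset (V × V)) := by
        refine card_le_mul_card_image_of_maps_to (f := fun x => x.2) (fun _ _ => mem_univ _) _
          fun p _ => ?_
        by_contra! h
        obtain ⟨⟨e₁, p₁⟩, h₁, ⟨e₂, p₂⟩, h₂, ⟨e₃, p₃⟩, h₃, h₁₂, h₁₃, h₂₃⟩ := two_lt_card.1 h
        simp only [mem_filter] at h₁ h₂ h₃
        obtain ⟨h₁, rfl⟩ := h₁
        obtain ⟨h₂, rfl⟩ := h₂
        obtain ⟨h₃, rfl⟩ := h₃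
        have h_path₁ := h_path _ h₁
        have h_path₂ := h_path _ h₂
        have h_path₃ := h_path _ h₃
        rcases h_path₁.not_three hfree h_path₂ h_path₃ with h | h | h
        · exact h₁₂ (congrArg (Sigma.mk · _) h)
        · exact h₁₃ (congrArg (Sigma.mk · _) h)
        · exact h₂₃ (congrArg (Sigma.mk · _) h)
    _ = 2 * Fintype.card V ^ 2 := by
        rw [card_univ, Fintype.card_prod, sq]

theorem sq_mul_card_orderedEdges_le (hfree : ¬ HasBorderedCycle G 3) (t : ℕ) :
    t ^ 2 * #G.orderedEdges ≤
      2 * Fintype.card V ^ 2 + t ^ 2 * (2 * ((2 * t + 1) * Fintype.card V)) := by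
  have h_cover : #G.orderedEdges ≤
      #{e ∈ G.orderedEdges | t ≤ #(G.outerSteps e) ∧ t ≤ #(G.innerSteps e)} +
        (#{e ∈ G.orderedEdges | #(G.outerSteps e) < t} +
          #{e ∈ G.orderedEdges | #(G.innerSteps e) < t}) := by
    refine (card_le_card fun e he => ?_).trans
      ((card_union_le _ _).trans (Nat.add_le_add_left (card_union_le _ _) _))
    simp only [mem_union, mem_filter, he, true_and]
    omega
  have h_many : #{e ∈ G.orderedEdges | t ≤ #(G.outerSteps e) ∧ t ≤ #(G.innerSteps e)} * t ^ 2 ≤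
      2 * Fintype.card V ^ 2 := by
    rw [← smul_eq_mul]
    refine le_trans (card_nsmul_le_sum _
      (fun e => #(G.outerSteps e) * #(G.innerSteps e)) _ fun e he => ?_)
      ((sum_le_sum_of_subset (filter_subset _ _)).trans
        (sum_card_outerSteps_mul_card_innerSteps_le hfree))
    rw [sq]
    exact Nat.mul_le_mul (mem_filter.1 he).2.1 (mem_filter.1 he).2.2
  have h_outer := card_filter_outerSteps_lt hfree t
  have h_inner := card_filter_innerSteps_lt hfree t
  calc t ^ 2 * #G.orderedEdges ≤ t ^ 2 *
      (#{e ∈ G.orderedEdges | t ≤ #(G.outerSteps e) ∧ t ≤ #(G.innerSteps e)} +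
        2 * ((2 * t + 1) * Fintype.card V)) := Nat.mul_le_mul_left _ (by omega)
    _ ≤ _ := by
      rw [mul_add, mul_comm (t ^ 2) (card _)]
      exact Nat.add_le_add_right h_many _

end Counting

end SimpleGraph

/-- Every ordered graph on `n` vertices that contains no bordered cycle of length `6` has at
most `18 * n ^ (4/3)` edges. -/
theorem bordered_hexagon_upper (n : ℕ) (G : SimpleGraph (Fin n))
    (hfree : ¬ HasBorderedCycle G 3) :
    (Nat.card G.edgeSet : ℝ) ≤ 18 * (n : ℝ) ^ ((4 : ℝ) / 3) := by
  rcases Nat.eq_zero_or_pos n with rfl | hn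
  · simp
  have h_count := SimpleGraph.sq_mul_card_orderedEdges_le hfree ⌈(n : ℝ) ^ ((1 : ℝ) / 3)⌉₊
  rw [← SimpleGraph.card_edgeSet_eq_card_orderedEdges, Fintype.card_fin] at h_count
  have hs : 1 ≤ (n : ℝ) ^ ((1 : ℝ) / 3) :=
    Real.one_le_rpow (by exact_mod_cast hn) (by norm_num)
  have h_cube : (n : ℝ) = ((n : ℝ) ^ ((1 : ℝ) / 3)) ^ 3 := by
    rw [← Real.rpow_natCast, ← Real.rpow_mul (Nat.cast_nonneg n)]
    norm_num
  have h_fourth : (n : ℝ) ^ ((4 : ℝ) / 3) = ((n : ℝ) ^ ((1 : ℝ) / 3)) ^ 4 := by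
    rw [← Real.rpow_natCast, ← Real.rpow_mul (Nat.cast_nonneg n)]
    norm_num
  have ht_le := (Nat.ceil_lt_add_one (zero_le_one.trans hs)).le
  have hle_t := Nat.le_ceil ((n : ℝ) ^ ((1 : ℝ) / 3))
  have h_count : (_ : ℝ) ≤ _ := Nat.cast_le.2 h_count
  push_cast at h_count
  rw [h_fourth]
  generalize (⌈(n : ℝ) ^ ((1 : ℝ) / 3)⌉₊ : ℝ) = t at *
  generalize (n : ℝ) ^ ((1 : ℝ) / 3) = s at *
  generalize (Nat.card G.edgeSet : ℝ) = m at *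
  rw [h_cube] at h_count
  have hs_cube : 0 ≤ s ^ 3 := by positivity
  have h_lower : 2 * ((2 * t + 1) * s ^ 3) ≤ 10 * s ^ 4 := by
    nlinarith [mul_le_mul_of_nonneg_right ht_le hs_cube, mul_le_mul_of_nonneg_right hs hs_cube]
  have h_upper : m - 2 * ((2 * t + 1) * s ^ 3) ≤ 2 * s ^ 4 := by
    by_contra! h
    have h_sq : s ^ 2 ≤ t ^ 2 := by gcongr
    have h_pos : 0 < s ^ 2 := by positivity
    have h_fourth_pos : 0 ≤ s ^ 4 := by positivity
    nlinarith [mul_lt_mul_of_pos_left h h_pos, mul_le_mul_of_nonneg_right h_sq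
      (show 0 ≤ m - 2 * ((2 * t + 1) * s ^ 3) by linarith)]
  linarith [show 0 ≤ s ^ 4 by positivity]
end

section
/- Let k, l ≥ 2 be integers such that l − 1 divides k − 1. Then every ordered graph G that contains no bordered cycle of length 2k has a subgraph G' (on the same vertex set, with the inherited vertex ordering) such that G' contains no bordered cycle of length 2l and G' has at least ((l−1)/(k−1))·|E(G)| edges. -/
/-- A bordered cycle visiting `p 0, q 0, p 1, q 1, …` with outer border `{x, y}` and inner border
`{z, w}`, where the left vertices `p` and the right vertices `q` need not be sorted. -/
structure IsBorderedTour {V : Type*} [LinearOrder V] (G : SimpleGraph V) (m : ℕ)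
    (p q : Fin (m + 2) → V) (x y z w : V) : Prop where
  left_inj : Function.Injective p
  right_inj : Function.Injective q
  lt : ∀ i j, p i < q j
  adj : ∀ s, G.Adj (p s) (q s)
  adj_succ : ∀ s, G.Adj (p (s + 1)) (q s)
  left_ge : ∀ i, x ≤ p i
  left_le : ∀ i, p i ≤ z
  right_ge : ∀ i, w ≤ q i
  right_le : ∀ i, q i ≤ y
  outer : ∃ s, q s = y ∧ (p s = x ∨ p (s + 1) = x)
  inner : ∃ s, q s = w ∧ (p s = z ∨ p (s + 1) = z)

namespace IsBorderedTour

variable {V : Type*} [LinearOrder V] {G : SimpleGraph V} {m : ℕ} {p q : Fin (m + 2) → V}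
  {x y z w : V}

theorem rotate (h : IsBorderedTour G m p q x y z w) (c : Fin (m + 2)) :
    IsBorderedTour G m (fun t => p (t + c)) (fun t => q (t + c)) x y z w where
  left_inj := h.left_inj.comp (add_left_injective c)
  right_inj := h.right_inj.comp (add_left_injective c)
  lt _ _ := h.lt _ _
  adj _ := h.adj _
  adj_succ s := by
    rw [add_right_comm]
    exact h.adj_succ _
  left_ge _ := h.left_ge _
  left_le _ := h.left_le _
  right_ge _ := h.right_ge _
  right_le _ := h.right_le _
  outer := by
    obtain ⟨s, hs⟩ := h.outer
    refine ⟨s - c, ?_⟩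
    rwa [add_right_comm, sub_add_cancel]
  inner := by
    obtain ⟨s, hs⟩ := h.inner
    refine ⟨s - c, ?_⟩
    rwa [add_right_comm, sub_add_cancel]

theorem reflect (h : IsBorderedTour G m p q x y z w) :
    IsBorderedTour G m (fun t => p (-t)) (fun t => q (-t - 1)) x y z w where
  left_inj := h.left_inj.comp neg_injective
  right_inj := h.right_inj.comp ((sub_left_injective).comp neg_injective)
  lt _ _ := h.lt _ _
  adj s := by simpa using h.adj_succ (-s - 1)
  adj_succ s := by
    rw [neg_add']
    exact h.adj _
  left_ge _ := h.left_ge _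
  left_le _ := h.left_le _
  right_ge _ := h.right_ge _
  right_le _ := h.right_le _
  outer := by
    obtain ⟨s, hs⟩ := h.outer
    refine ⟨-s - 1, ?_⟩
    simpa [or_comm, add_comm 1 s] using hs
  inner := by
    obtain ⟨s, hs⟩ := h.inner
    refine ⟨-s - 1, ?_⟩
    simpa [or_comm, add_comm 1 s] using hs

/-- Any edge of a tour may be taken as its closing edge. -/
theorem exists_closing (h : IsBorderedTour G m p q x y z w) {c d : V}
    (hcd : ∃ s, q s = d ∧ (p s = c ∨ p (s + 1) = c)) :
    ∃ p' q', IsBorderedTour G m p' q' x y z w ∧ p' 0 = c ∧ q' (Fin.last (m + 1)) = d := by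
  have hlast : Fin.last (m + 1) = -1 := by
    rw [eq_neg_iff_add_eq_zero, Fin.last_add_one]
  obtain ⟨s, hd, hc | hc⟩ := hcd
  · refine ⟨_, _, (h.reflect.rotate (-s)), ?_, ?_⟩
    · simpa using hc
    · simpa [hlast] using hd
  · refine ⟨_, _, (h.rotate (s + 1)), ?_, ?_⟩
    · simpa using hc
    · simpa [hlast] using hd

theorem hasBorderedCycleWith (h : IsBorderedTour G m p q x y z w) :
    HasBorderedCycleWith G (m + 2) s(x, y) s(z, w) := by
  have sorted : ∀ r : Fin (m + 2) → V, Function.Injective r →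
      ∃ (u : Fin (m + 2) → V) (a : Equiv.Perm (Fin (m + 2))), StrictMono u ∧
        ∀ s, u (a s) = r s := by
    intro r hr
    have hcard : (Finset.univ.image r).card = m + 2 := by
      rw [Finset.card_image_of_injective _ hr, Finset.card_univ, Fintype.card_fin]
    have hmem : ∀ s, ∃ t, (Finset.univ.image r).orderEmbOfFin hcard t = r s := by
      intro s
      have : r s ∈ Set.range ((Finset.univ.image r).orderEmbOfFin hcard) := by
        rw [Finset.range_orderEmbOfFin]
        simp
      exact this
    choose a ha using hmem
    have ha_inj : Function.Injective a := fun s t hst => hr (by rw [← ha s, ← ha t, hst])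
    exact ⟨_, Equiv.ofBijective a (Finite.injective_iff_bijective.mp ha_inj),
      ((Finset.univ.image r).orderEmbOfFin hcard).strictMono, ha⟩
  obtain ⟨u, a, hu, hua⟩ := sorted p h.left_inj
  obtain ⟨v, b, hv, hvb⟩ := sorted q h.right_inj
  have hup : ∀ i, u i = p (a.symm i) := fun i => by simp [← hua]
  have hvq : ∀ i, v i = q (b.symm i) := fun i => by simp [← hvb]
  obtain ⟨s, hsy, hsx⟩ := h.outer
  obtain ⟨t, htw, htz⟩ := h.inner
  have hx : u 0 = x := by
    refine le_antisymm ?_ ((hup 0).symm ▸ h.left_ge _)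
    rcases hsx with hsx | hsx <;> rw [← hsx, ← hua] <;> exact hu.monotone (Fin.zero_le _)
  have hz : u (Fin.last (m + 1)) = z := by
    refine le_antisymm ((hup _).symm ▸ h.left_le _) ?_
    rcases htz with htz | htz <;> rw [← htz, ← hua] <;> exact hu.monotone (Fin.le_last _)
  have hw : v 0 = w := by
    refine le_antisymm ?_ ((hvq 0).symm ▸ h.right_ge _)
    rw [← htw, ← hvb]
    exact hv.monotone (Fin.zero_le _)
  have hy : v (Fin.last (m + 1)) = y := by
    refine le_antisymm ((hvq _).symm ▸ h.right_le _) ?_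
    rw [← hsy, ← hvb]
    exact hv.monotone (Fin.le_last _)
  have hbs : b s = Fin.last (m + 1) := hv.injective (by rw [hvb, hsy, hy])
  have hbt : b t = 0 := hv.injective (by rw [hvb, htw, hw])
  refine ⟨m, rfl, u, v, a, b, hu, hv, ?_, ?_, ?_, ⟨s, ?_⟩, ⟨t, ?_⟩, ?_, ?_⟩
  · rw [hup, hvq]
    exact h.lt _ _
  · intro i
    rw [hua, hvb]
    exact h.adj i
  · intro i
    rw [hua, hvb]
    exact h.adj_succ i
  · exact hsx.imp (fun e => ⟨hu.injective (by rw [hua, e, hx]), hbs⟩)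
      (fun e => ⟨hu.injective (by rw [hua, e, hx]), hbs⟩)
  · exact htz.imp (fun e => ⟨hu.injective (by rw [hua, e, hz]), hbt⟩)
      (fun e => ⟨hu.injective (by rw [hua, e, hz]), hbt⟩)
  · rw [hx, hy]
  · rw [hz, hw]

/-- Two tours such that the closing edge `{z, w}` of both is the inner border of the first and the
outer border of the second. -/
theorem merge {n : ℕ} {p' q' : Fin (n + 2) → V} {c d : V}
    (h : IsBorderedTour G m p q x y z w) (h' : IsBorderedTour G n p' q' z w c d)
    (hp : p 0 = z) (hq : q (Fin.last (m + 1)) = w)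
    (hp' : p' 0 = z) (hq' : q' (Fin.last (n + 1)) = w) :
    ∃ A B, IsBorderedTour G (m + n + 1) A B x y c d := by
  have hofNat : ∀ {r i : ℕ}, i < r + 2 → (Fin.ofNat (r + 2) i).val = i :=
    fun hi => Nat.mod_eq_of_lt hi
  have hsucc : ∀ r i : ℕ, Fin.ofNat (r + 2) (i + 1) = Fin.ofNat (r + 2) i + 1 := by
    intro r i
    ext
    simp [Fin.val_add, Nat.add_mod]
  have hlast : ∀ r : ℕ, Fin.ofNat (r + 2) (r + 1) = Fin.last (r + 1) := by
    intro r
    ext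
    simp
  have hinj : ∀ {r : ℕ} {f : Fin (r + 2) → V}, Function.Injective f → ∀ {i j : ℕ}, i < r + 2 →
      j < r + 2 → f (Fin.ofNat _ i) = f (Fin.ofNat _ j) → i = j := by
    intro r f hf i j hi hj hij
    rw [← hofNat hi, ← hofNat hj, hf hij]
  have hne : ∀ r : ℕ, (0 : Fin (r + 2)) ≠ Fin.last (r + 1) := fun r => (Fin.last_pos).ne
  have hwy : y ≠ w := by
    rintro rfl
    exact hne m (h.right_inj ((le_antisymm (h.right_le 0) (h.right_ge 0)).trans hq.symm))
  have hdw : d ≠ w := by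
    rintro rfl
    exact hne n (h'.right_inj ((le_antisymm (h'.right_le 0) (h'.right_ge 0)).trans hq'.symm))
  -- the merged tour follows the first tour and then the second one backwards
  let A : ℕ → V := fun i =>
    if i < m + 2 then p (Fin.ofNat _ i) else p' (Fin.ofNat _ (m + n + 3 - i))
  let B : ℕ → V := fun i =>
    if i < m + 2 then q (Fin.ofNat _ i) else q' (Fin.ofNat _ (m + n + 2 - i))
  have hA₁ : ∀ i, i < m + 2 → A i = p (Fin.ofNat _ i) := fun i hi => if_pos hi
  have hB₁ : ∀ i, i < m + 2 → B i = q (Fin.ofNat _ i) := fun i hi => if_pos hi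
  have hA₂ : ∀ i j, i + j = m + n + 3 → j < n + 2 → A i = p' (Fin.ofNat _ j) := by
    intro i j hij hj
    rw [show A i = _ from if_neg (by omega), show m + n + 3 - i = j by omega]
  have hB₂ : ∀ i j, i + j = m + n + 2 → j < n + 1 → B i = q' (Fin.ofNat _ j) := by
    intro i j hij hj
    rw [show B i = _ from if_neg (by omega), show m + n + 2 - i = j by omega]
  have hpz : ∀ j, 0 < j → j < n + 2 → z < p' (Fin.ofNat _ j) := by
    intro j hj₀ hj
    refine lt_of_le_of_ne (h'.left_ge _) fun e => hj₀.ne ?_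
    exact hinj h'.left_inj (by omega) hj (hp'.trans e)
  have hqw : ∀ j, j < n + 1 → q' (Fin.ofNat _ j) < w := by
    intro j hj
    refine lt_of_le_of_ne (h'.right_le _) fun e => hj.ne ?_
    refine hinj h'.right_inj (by omega) (by omega) (e.trans ?_)
    rw [hlast, hq']
  have hzw : z < w := hp ▸ hq ▸ h.lt _ _
  have hA_inj : ∀ i < m + n + 3, ∀ j < m + n + 3, A i = A j → i = j := by
    intro i hi j hj hij
    by_cases hi' : i < m + 2 <;> by_cases hj' : j < m + 2
    · rw [hA₁ i hi', hA₁ j hj'] at hij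
      exact hinj h.left_inj hi' hj' hij
    · rw [hA₁ i hi', hA₂ j (m + n + 3 - j) (by omega) (by omega)] at hij
      exact absurd hij ((h.left_le _).trans_lt (hpz _ (by omega) (by omega))).ne
    · rw [hA₁ j hj', hA₂ i (m + n + 3 - i) (by omega) (by omega)] at hij
      exact absurd hij ((h.left_le _).trans_lt (hpz _ (by omega) (by omega))).ne'
    · rw [hA₂ i (m + n + 3 - i) (by omega) (by omega),
        hA₂ j (m + n + 3 - j) (by omega) (by omega)] at hij
      have := hinj h'.left_inj (by omega) (by omega) hij
      omega
  have hB_inj : ∀ i < m + n + 3, ∀ j < m + n + 3, B i = B j → i = j := by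
    intro i hi j hj hij
    by_cases hi' : i < m + 2 <;> by_cases hj' : j < m + 2
    · rw [hB₁ i hi', hB₁ j hj'] at hij
      exact hinj h.right_inj hi' hj' hij
    · rw [hB₁ i hi', hB₂ j (m + n + 2 - j) (by omega) (by omega)] at hij
      exact absurd hij ((hqw _ (by omega)).trans_le (h.right_ge _)).ne'
    · rw [hB₁ j hj', hB₂ i (m + n + 2 - i) (by omega) (by omega)] at hij
      exact absurd hij ((hqw _ (by omega)).trans_le (h.right_ge _)).ne
    · rw [hB₂ i (m + n + 2 - i) (by omega) (by omega),
        hB₂ j (m + n + 2 - j) (by omega) (by omega)] at hij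
      have := hinj h'.right_inj (by omega) (by omega) hij
      omega
  have hA_mem : ∀ i : ℕ, x ≤ A i ∧ A i ≤ c := by
    intro i
    have hxz : x ≤ z := hp ▸ h.left_ge 0
    have hzc : z ≤ c := hp' ▸ h'.left_le 0
    by_cases hi : i < m + 2
    · rw [hA₁ i hi]
      exact ⟨h.left_ge _, (h.left_le _).trans hzc⟩
    · rw [show A i = _ from if_neg hi]
      exact ⟨hxz.trans (h'.left_ge _), h'.left_le _⟩
  have hB_mem : ∀ i : ℕ, d ≤ B i ∧ B i ≤ y := by
    intro i
    have hwy : w ≤ y := hq ▸ h.right_le _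
    have hdw : d ≤ w := hq' ▸ h'.right_ge _
    by_cases hi : i < m + 2
    · rw [hB₁ i hi]
      exact ⟨hdw.trans (h.right_ge _), h.right_le _⟩
    · rw [show B i = _ from if_neg hi]
      exact ⟨h'.right_ge _, (h'.right_le _).trans hwy⟩
  have hcd : c < d := by
    obtain ⟨s, rfl, rfl | rfl⟩ := h'.inner <;> exact h'.lt _ _
  have hA_succ : ∀ s : Fin (m + n + 3), A (s + 1 : Fin (m + n + 3)) = A (s + 1 : ℕ) := by
    intro s
    rcases eq_or_ne s (Fin.last (m + n + 2)) with rfl | hs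
    · rw [Fin.last_add_one, Fin.val_last, hA₂ (m + n + 2 + 1) 0 (by omega) (by omega)]
      exact hp.trans hp'.symm
    · rw [Fin.val_add_one_of_lt (Fin.lt_last_iff_ne_last.mpr hs)]
  refine ⟨fun i => A i, fun i => B i, ?_, ?_, ?_, ?_, ?_, ?_, ?_, ?_, ?_, ?_, ?_⟩
  · exact fun i j hij => Fin.ext (hA_inj _ i.2 _ j.2 hij)
  · exact fun i j hij => Fin.ext (hB_inj _ i.2 _ j.2 hij)
  · exact fun i j => (hA_mem i).2.trans_lt (hcd.trans_le (hB_mem j).1)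
  · intro s
    have hs := s.2
    by_cases hs' : s.val < m + 2
    · rw [hA₁ s hs', hB₁ s hs']
      exact h.adj _
    · rw [hA₂ s (m + n + 2 - s + 1) (by omega) (by omega), hB₂ s (m + n + 2 - s) (by omega)
        (by omega), hsucc]
      exact h'.adj_succ _
  · intro s
    have hs := s.2
    rw [hA_succ]
    rcases lt_trichotomy s.val (m + 1) with hs' | hs' | hs'
    · rw [hA₁ (s + 1) (by omega), hB₁ s (by omega), hsucc]
      exact h.adj_succ _
    · rw [hA₂ (s + 1) (n + 1) (by omega) (by omega), hB₁ s (by omega), hs', hlast, hlast, hq, ← hq']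
      exact h'.adj _
    · rw [hA₂ (s + 1) (m + n + 2 - s) (by omega) (by omega), hB₂ s (m + n + 2 - s) (by omega)
        (by omega)]
      exact h'.adj _
  · exact fun i => (hA_mem i).1
  · exact fun i => (hA_mem i).2
  · exact fun i => (hB_mem i).1
  · exact fun i => (hB_mem i).2
  · obtain ⟨s, hsy, hsx⟩ := h.outer
    have hs : s.val < m + 1 := by
      refine lt_of_le_of_ne (Nat.le_of_lt_succ s.2) fun e => hwy ?_
      rw [← hsy, ← hq, show s = Fin.last (m + 1) from Fin.ext e]
    have hcast : Fin.ofNat (m + 2) s.val = s := Fin.ext (hofNat s.2)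
    refine ⟨⟨s, by omega⟩, ?_⟩
    rw [hA_succ, hB₁ s (by omega), hA₁ s (by omega), hA₁ (s + 1) (by omega), hsucc, hcast]
    exact ⟨hsy, hsx⟩
  · obtain ⟨s, hsd, hsc⟩ := h'.inner
    have hs : s.val < n + 1 := by
      refine lt_of_le_of_ne (Nat.le_of_lt_succ s.2) fun e => hdw ?_
      rw [← hsd, ← hq', show s = Fin.last (n + 1) from Fin.ext e]
    have hcast : Fin.ofNat (n + 2) s.val = s := Fin.ext (hofNat s.2)
    refine ⟨⟨m + n + 2 - s, by omega⟩, ?_⟩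
    rw [hA_succ, hB₂ (m + n + 2 - s) s (by omega) (by omega),
      hA₂ (m + n + 2 - s) (s + 1) (by omega) (by omega),
      hA₂ (m + n + 2 - s + 1) s (by omega) (by omega), hsucc, hcast]
    exact ⟨hsd, hsc.symm⟩

end IsBorderedTour

namespace HasBorderedCycleWith

variable {V : Type*} [LinearOrder V] {G : SimpleGraph V} {l : ℕ} {e f : Sym2 V}

theorem exists_tour (h : HasBorderedCycleWith G l e f) :
    ∃ m p q x y z w, l = m + 2 ∧ e = s(x, y) ∧ f = s(z, w) ∧
      IsBorderedTour G m p q x y z w := by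
  obtain ⟨m, rfl, u, v, a, b, hu, hv, huv, hadj, hadj', ⟨s, hs⟩, ⟨t, ht⟩, rfl, rfl⟩ := h
  refine ⟨m, u ∘ a, v ∘ b, _, _, _, _, rfl, rfl, rfl, hu.injective.comp a.injective,
    hv.injective.comp b.injective, fun i j => ?_, hadj, hadj',
    fun _ => hu.monotone (Fin.zero_le _), fun _ => hu.monotone (Fin.le_last _),
    fun _ => hv.monotone (Fin.zero_le _), fun _ => hv.monotone (Fin.le_last _), ⟨s, ?_⟩, ⟨t, ?_⟩⟩
  · exact (hu.monotone (Fin.le_last _)).trans_lt (huv.trans_le (hv.monotone (Fin.zero_le _)))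
  · rcases hs with ⟨h₁, h₂⟩ | ⟨h₁, h₂⟩ <;> simp [h₁, h₂]
  · rcases ht with ⟨h₁, h₂⟩ | ⟨h₁, h₂⟩ <;> simp [h₁, h₂]

theorem mono {H : SimpleGraph V} (hGH : G ≤ H) (h : HasBorderedCycleWith G l e f) :
    HasBorderedCycleWith H l e f := by
  obtain ⟨m, hl, u, v, a, b, hu, hv, huv, hadj, hadj', hrest⟩ := h
  exact ⟨m, hl, u, v, a, b, hu, hv, huv, fun s => hGH (hadj s), fun s => hGH (hadj' s), hrest⟩

theorem mem_edgeSet (h : HasBorderedCycleWith G l e f) : e ∈ G.edgeSet ∧ f ∈ G.edgeSet := by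
  obtain ⟨m, p, q, x, y, z, w, rfl, rfl, rfl, hT⟩ := h.exists_tour
  obtain ⟨s, rfl, rfl | rfl⟩ := hT.outer <;> obtain ⟨t, rfl, rfl | rfl⟩ := hT.inner <;>
    simp [hT.adj, hT.adj_succ]

/-- Two bordered cycles, the inner border of the first being the outer border of the second, merge
into one bordered cycle after the removal of the shared border. -/
theorem trans {l' : ℕ} {g : Sym2 V} (h : HasBorderedCycleWith G l e f)
    (h' : HasBorderedCycleWith G l' f g) : HasBorderedCycleWith G (l + l' - 1) e g := by
  obtain ⟨m, p, q, x, y, z, w, rfl, rfl, rfl, hT⟩ := h.exists_tour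
  obtain ⟨n, p', q', z', w', c, d, rfl, hf, rfl, hT'⟩ := h'.exists_tour
  obtain ⟨p, q, hT, hp, hq⟩ := hT.exists_closing hT.inner
  obtain ⟨p', q', hT', hp', hq'⟩ := hT'.exists_closing hT'.outer
  have hzw : z < w := hp ▸ hq ▸ hT.lt _ _
  have hzw' : z' < w' := hp' ▸ hq' ▸ hT'.lt _ _
  obtain ⟨rfl, rfl⟩ : z = z' ∧ w = w' := by
    rcases Sym2.eq_iff.mp hf with hf | ⟨rfl, rfl⟩
    · exact hf
    · exact absurd hzw hzw'.asymm
  obtain ⟨A, B, hAB⟩ := hT.merge hT' hp hq hp' hq'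
  convert hAB.hasBorderedCycleWith using 1
  omega

end HasBorderedCycleWith

/-- **Deleting small bordered cycles.** Let `k, l ≥ 2` with `l - 1` dividing `k - 1`.  Every
ordered graph `G` containing no bordered cycle of length `2 * k` has a subgraph `G'` (on the
same vertex set, with the inherited ordering) containing no bordered cycle of length `2 * l`
and having at least `(l - 1)/(k - 1)` fraction of the edges of `G`. -/
theorem bordered_cycle_deletion {V : Type*} [LinearOrder V] [Fintype V]
    (k l : ℕ) (hk : 2 ≤ k) (hl : 2 ≤ l) (hdvd : (l - 1) ∣ (k - 1))
    (G : SimpleGraph V) (hfree : ¬ HasBorderedCycle G k) :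
    ∃ G' : SimpleGraph V, G' ≤ G ∧ ¬ HasBorderedCycle G' l ∧
      (((l : ℝ) - 1) / ((k : ℝ) - 1)) * (Nat.card G.edgeSet : ℝ) ≤
        (Nat.card G'.edgeSet : ℝ) := by
  classical
  obtain ⟨r, rfl⟩ : ∃ r, l = r + 1 := ⟨l - 1, by omega⟩
  obtain ⟨t, ht⟩ := hdvd
  obtain rfl : k = r * t + 1 := by
    rw [Nat.add_sub_cancel] at ht
    omega
  have hr : 0 < r := by omega
  have ht0 : 0 < t := Nat.pos_of_ne_zero (by rintro rfl; simp at hk)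
  -- the length, capped at `t - 1`, of a longest chain of merged cycles with outer border `e`
  let starts : Sym2 V → ℕ → Prop := fun e j =>
    j = 0 ∨ ∃ f, HasBorderedCycleWith G (r * j + 1) e f
  let depth : Sym2 V → ℕ := fun e => Nat.findGreatest (starts e) (t - 1)
  have hdepth : ∀ e f, HasBorderedCycleWith G (r + 1) e f → depth f < depth e := by
    intro e f hef
    have hspec : starts f (depth f) := Nat.findGreatest_spec (Nat.zero_le _) (Or.inl rfl)
    obtain ⟨g, hg⟩ : ∃ g, HasBorderedCycleWith G (r * (depth f + 1) + 1) e g := by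
      rcases hspec with h0 | ⟨g, hg⟩
      · exact ⟨f, by simpa [h0] using hef⟩
      · refine ⟨g, ?_⟩
        convert hef.trans hg using 1
        rw [mul_add]
        omega
    have hle : depth f ≤ t - 1 := Nat.findGreatest_le _
    have hne : depth f + 1 ≠ t := by
      intro h
      rw [h] at hg
      exact hfree ⟨_, _, hg⟩
    exact Nat.le_findGreatest (by omega) (Or.inr ⟨g, hg⟩)
  obtain ⟨j, -, hj⟩ := Finset.exists_le_card_fiber_of_nsmul_le_card_of_maps_to
    (s := G.edgeFinset) (t := Finset.range t) (f := depth) (b := (G.edgeFinset.card : ℝ) / t)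
    (fun e _ => Finset.mem_range.mpr (by
      have : depth e ≤ t - 1 := Nat.findGreatest_le _
      omega))
    ⟨0, Finset.mem_range.mpr ht0⟩
    (by
      rw [Finset.card_range, nsmul_eq_mul, mul_div_cancel₀]
      positivity)
  have hedge : (SimpleGraph.fromEdgeSet {e ∈ G.edgeSet | depth e = j}).edgeSet =
      {e ∈ G.edgeSet | depth e = j} := by
    rw [SimpleGraph.edgeSet_fromEdgeSet, sdiff_eq_left, Set.disjoint_left]
    exact fun e he => G.not_isDiag_of_mem_edgeSet he.1
  have hle : SimpleGraph.fromEdgeSet {e ∈ G.edgeSet | depth e = j} ≤ G := by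
    rw [← SimpleGraph.edgeSet_subset_edgeSet, hedge]
    exact Set.sep_subset _ _
  refine ⟨_, hle, ?_, ?_⟩
  · rintro ⟨e, f, hef⟩
    have hmem := hef.mem_edgeSet
    rw [hedge] at hmem
    have := hdepth e f (hef.mono hle)
    rw [hmem.1.2, hmem.2.2] at this
    exact this.false
  · have hcard : Nat.card G.edgeSet = G.edgeFinset.card := by
      rw [Nat.card_eq_fintype_card, SimpleGraph.edgeFinset_card]
    have hcard' : Nat.card {e ∈ G.edgeSet | depth e = j} =
        (G.edgeFinset.filter (fun e => depth e = j)).card := by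
      rw [Nat.card_coe_set_eq, ← Set.ncard_coe_finset]
      congr 1
      ext e
      simp
    rw [hedge, hcard, hcard']
    refine le_trans (le_of_eq ?_) hj
    push_cast
    have hr' : (r : ℝ) ≠ 0 := by positivity
    have ht' : (t : ℝ) ≠ 0 := by positivity
    rw [add_sub_cancel_right, add_sub_cancel_right]
    field_simp
end

section
/- Let k ≥ 2 be an integer and let G be an ordered graph that contains no bordered cycle of length 2l for any 2 ≤ l ≤ k. Then for every pair of vertices x, y of G there is at most one k-zigzag path v_0 v_1 … v_k in G with v_0 = x and v_k = y. -/
/-- `IsZigzagPath G p` says that `p 0, p 1, …, p k` is a `k`-zigzag path in the ordered graph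
`G`: consecutive vertices are adjacent, and the vertices are ordered as
`p k < p (k-2) < ⋯ < p 2 < p 0 < p 1 < p 3 < ⋯ < p (k-1)` when `k` is even, and
`p (k-1) < p (k-3) < ⋯ < p 2 < p 0 < p 1 < p 3 < ⋯ < p k` when `k` is odd.
Equivalently (uniformly in the parity of `k`): the vertices at even positions are strictly
decreasing, those at odd positions are strictly increasing, and every vertex at an even
position precedes every vertex at an odd position.  In particular all vertices are distinct,
so `p` is a path. -/
def IsZigzagPath {V : Type*} [LinearOrder V] (G : SimpleGraph V) {k : ℕ}
    (p : Fin (k + 1) → V) : Prop :=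
  (∀ i : Fin k, G.Adj (p i.castSucc) (p i.succ)) ∧
  (∀ i j : Fin (k + 1), Even (i : ℕ) → Even (j : ℕ) → i < j → p j < p i) ∧
  (∀ i j : Fin (k + 1), Odd (i : ℕ) → Odd (j : ℕ) → i < j → p i < p j) ∧
  (∀ i j : Fin (k + 1), Even (i : ℕ) → Odd (j : ℕ) → p i < p j)

theorem HasBorderedCycle.of_orderDual {V : Type*} [LinearOrder V] {G : SimpleGraph V} {l : ℕ}
    (h : HasBorderedCycle (V := Vᵒᵈ) G l) : HasBorderedCycle G l := by
  obtain ⟨_, _, m, rfl, u, v, a, b, hu, hv, huv, h1, h2, ho, hi, -, -⟩ := h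
  refine ⟨_, _, m, rfl, fun i => OrderDual.ofDual (v i.rev), fun i => OrderDual.ofDual (u i.rev),
    b.trans Fin.revPerm, ((Equiv.addRight 1).trans a).trans Fin.revPerm,
    fun i j hij => hv (Fin.rev_lt_rev.2 hij), fun i j hij => hu (Fin.rev_lt_rev.2 hij),
    ?_, fun s => ?_, fun s => ?_, ?_, ?_, rfl, rfl⟩
  · simpa using huv
  · simp only [Equiv.trans_apply, Equiv.coe_addRight, Fin.revPerm_apply, Fin.rev_rev]
    exact SimpleGraph.Adj.symm (h2 s)
  · simp only [Equiv.trans_apply, Equiv.coe_addRight, Fin.revPerm_apply, Fin.rev_rev]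
    exact SimpleGraph.Adj.symm (h1 (s + 1))
  · obtain ⟨s, ⟨hs, hs'⟩ | ⟨hs, hs'⟩⟩ := ho
    · exact ⟨s - 1, Or.inr (by simp [hs, hs'])⟩
    · exact ⟨s, Or.inl (by simp [hs, hs'])⟩
  · obtain ⟨s, ⟨hs, hs'⟩ | ⟨hs, hs'⟩⟩ := hi
    · exact ⟨s - 1, Or.inr (by simp [hs, hs'])⟩
    · exact ⟨s, Or.inl (by simp [hs, hs'])⟩

/-- An injective tuple is the composition of a strictly increasing tuple with a permutation. -/
theorem exists_strictMono_comp_perm {V : Type*} [LinearOrder V] {n : ℕ} {f : Fin n → V}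
    (hf : Function.Injective f) :
    ∃ (u : Fin n → V) (a : Equiv.Perm (Fin n)), StrictMono u ∧ ∀ s, u (a s) = f s :=
  ⟨f ∘ Tuple.sort f, (Tuple.sort f).symm,
    (Tuple.monotone_sort f).strictMono_of_injective (hf.comp (Tuple.sort f).injective),
    fun s => by simp⟩

/-- A cycle visiting `f 0, g 0, f 1, g 1, …` is bordered if the extreme vertices are joined
by edges of the cycle. -/
theorem HasBorderedCycle.of_tuples {V : Type*} [LinearOrder V] {G : SimpleGraph V} {m : ℕ}
    {f g : Fin (m + 2) → V} (hf : Function.Injective f) (hg : Function.Injective g)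
    (hfg : ∀ s t, f s < g t) (h1 : ∀ s, G.Adj (f s) (g s)) (h2 : ∀ s, G.Adj (f (s + 1)) (g s))
    (ho : ∃ s s', (s' = s ∨ s' = s + 1) ∧ (∀ t, f s' ≤ f t) ∧ ∀ t, g t ≤ g s)
    (hi : ∃ s s', (s' = s ∨ s' = s + 1) ∧ (∀ t, f t ≤ f s') ∧ ∀ t, g s ≤ g t) :
    HasBorderedCycle G (m + 2) := by
  obtain ⟨u, a, hu, hua⟩ := exists_strictMono_comp_perm hf
  obtain ⟨v, b, hv, hvb⟩ := exists_strictMono_comp_perm hg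
  have eq_zero : ∀ {w : Fin (m + 2) → V} {h : Fin (m + 2) → V} {c : Equiv.Perm (Fin (m + 2))}
      {s}, StrictMono w → (∀ t, w (c t) = h t) → (∀ t, h s ≤ h t) → c s = 0 := by
    intro w h c s hw hc hs
    have := hs (c.symm 0)
    rw [← hc, ← hc, hw.le_iff_le, Equiv.apply_symm_apply] at this
    exact Fin.le_zero_iff.1 this
  have eq_last : ∀ {w : Fin (m + 2) → V} {h : Fin (m + 2) → V} {c : Equiv.Perm (Fin (m + 2))}
      {s}, StrictMono w → (∀ t, w (c t) = h t) → (∀ t, h t ≤ h s) → c s = Fin.last (m + 1) := by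
    intro w h c s hw hc hs
    have := hs (c.symm (Fin.last _))
    rw [← hc, ← hc, hw.le_iff_le, Equiv.apply_symm_apply] at this
    exact Fin.last_le_iff.1 this
  refine ⟨_, _, m, rfl, u, v, a, b, hu, hv, ?_, fun s => ?_, fun s => ?_, ?_, ?_, rfl, rfl⟩
  · have := hfg (a.symm (Fin.last _)) (b.symm 0)
    rwa [← hua, ← hvb, Equiv.apply_symm_apply, Equiv.apply_symm_apply] at this
  · rw [hua, hvb]; exact h1 s
  · rw [hua, hvb]; exact h2 s
  · obtain ⟨s, s', hs, hmin, hmax⟩ := ho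
    refine ⟨s, ?_⟩
    rcases hs with rfl | rfl
    · exact Or.inl ⟨eq_zero hu hua hmin, eq_last hv hvb hmax⟩
    · exact Or.inr ⟨eq_zero hu hua hmin, eq_last hv hvb hmax⟩
  · obtain ⟨s, s', hs, hmax, hmin⟩ := hi
    refine ⟨s, ?_⟩
    rcases hs with rfl | rfl
    · exact Or.inl ⟨eq_last hu hua hmax, eq_zero hv hvb hmin⟩
    · exact Or.inr ⟨eq_last hu hua hmax, eq_zero hv hvb hmin⟩

/-- A closed walk `d 0, d 1, …, d (2 * l) = d 0` without further repetitions is a bordered cycle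
if it alternates between the two sides and contains the two border edges. -/
theorem HasBorderedCycle.of_closed {V : Type*} [LinearOrder V] {G : SimpleGraph V} {l : ℕ}
    (hl : 2 ≤ l) {d : ℕ → V} (hd : d (2 * l) = d 0)
    (hadj : ∀ t < 2 * l, G.Adj (d t) (d (t + 1)))
    (hinj : ∀ s < 2 * l, ∀ t < 2 * l, d s = d t → s = t)
    (hlr : ∀ s ≤ 2 * l, ∀ t ≤ 2 * l, Even s → Odd t → d s < d t)
    (ho : ∃ i ≤ 2 * l, ∃ j ≤ 2 * l, Odd j ∧ (i + 1 = j ∨ i = j + 1) ∧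
      (∀ s ≤ 2 * l, Even s → d i ≤ d s) ∧ ∀ s ≤ 2 * l, Odd s → d s ≤ d j)
    (hi : ∃ i ≤ 2 * l, ∃ j ≤ 2 * l, Odd j ∧ (i + 1 = j ∨ i = j + 1) ∧
      (∀ s ≤ 2 * l, Even s → d s ≤ d i) ∧ ∀ s ≤ 2 * l, Odd s → d j ≤ d s) :
    HasBorderedCycle G l := by
  obtain ⟨m, rfl⟩ := Nat.exists_eq_add_of_le' hl
  have hsucc : ∀ s : Fin (m + 2), d (2 * (s + 1 : Fin (m + 2)).val) = d (2 * s.val + 1 + 1) := by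
    intro s
    by_cases hs : s = Fin.last (m + 1)
    · subst hs
      simp only [Fin.last_add_one, Fin.val_last, Fin.val_zero, mul_zero]
      exact hd.symm
    · rw [Fin.val_add_one_of_lt (Fin.lt_last_iff_ne_last.2 hs)]
      rfl
  have border : ∀ i ≤ 2 * (m + 2), ∀ j ≤ 2 * (m + 2), Odd j → (i + 1 = j ∨ i = j + 1) →
      ∃ s s' : Fin (m + 2), (s' = s ∨ s' = s + 1) ∧ d (2 * s'.val) = d i ∧
        2 * s.val + 1 = j := by
    rintro i hi _ hj ⟨s, rfl⟩ h
    refine ⟨⟨s, by omega⟩, ?_⟩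
    rcases h with h | h
    · exact ⟨⟨s, by omega⟩, Or.inl rfl, by congr 1; simp; omega, rfl⟩
    · exact ⟨_, Or.inr rfl, by rw [hsucc, h], rfl⟩
  refine HasBorderedCycle.of_tuples (f := fun s => d (2 * s.val)) (g := fun s => d (2 * s.val + 1))
    (fun s t h => ?_) (fun s t h => ?_) (fun s t => ?_) (fun s => ?_) (fun s => ?_) ?_ ?_
  · have := hinj _ (by omega) _ (by omega) h
    omega
  · have := hinj _ (by omega) _ (by omega) h
    omega
  · exact hlr _ (by omega) _ (by omega) (by simp) (by simp)
  · exact hadj _ (by omega)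
  · rw [hsucc]
    exact (hadj _ (by omega)).symm
  · obtain ⟨i, hi, j, hj, hodd, hij, hmin, hmax⟩ := ho
    obtain ⟨s, s', hs, h1, rfl⟩ := border i hi j hj hodd hij
    refine ⟨s, s', hs, fun t => ?_, fun t => hmax _ (by omega) (by simp)⟩
    rw [h1]
    exact hmin _ (by omega) (by simp)
  · obtain ⟨i, hi, j, hj, hodd, hij, hmax, hmin⟩ := hi
    obtain ⟨s, s', hs, h1, rfl⟩ := border i hi j hj hodd hij
    refine ⟨s, s', hs, fun t => ?_, fun t => hmin _ (by omega) (by simp)⟩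
    rw [h1]
    exact hmax _ (by omega) (by simp)

/-- A zigzag path, read off as a sequence indexed by the natural numbers up to `k`. -/
theorem IsZigzagPath.exists_seq {V : Type*} [LinearOrder V] {G : SimpleGraph V} {k : ℕ}
    {p : Fin (k + 1) → V} (hp : IsZigzagPath G p) :
    ∃ P : ℕ → V, (∀ i : Fin (k + 1), P i = p i) ∧ (∀ i < k, G.Adj (P i) (P (i + 1))) ∧
      (∀ i j, Even i → Even j → i < j → j ≤ k → P j < P i) ∧
      (∀ i j, Odd i → Odd j → i < j → j ≤ k → P i < P j) ∧
      (∀ i j, Even i → Odd j → i ≤ k → j ≤ k → P i < P j) := by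
  obtain ⟨h1, h2, h3, h4⟩ := hp
  have hP : ∀ i (hi : i ≤ k), p (Fin.ofNat (k + 1) i) = p ⟨i, by omega⟩ := fun i hi => by
    congr 1
    ext
    simp [Nat.mod_eq_of_lt (show i < k + 1 by omega)]
  refine ⟨fun i => p (Fin.ofNat (k + 1) i), fun i => hP i (by omega), fun i hi => ?_,
    fun i j hi hj hij hk => ?_, fun i j hi hj hij hk => ?_, fun i j hi hj hik hjk => ?_⟩
  · simp only [hP i (by omega), hP (i + 1) (by omega)]
    exact h1 ⟨i, hi⟩
  · simp only [hP i (by omega), hP j (by omega)]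
    exact h2 _ _ hi hj hij
  · simp only [hP i (by omega), hP j (by omega)]
    exact h3 _ _ hi hj hij
  · simp only [hP i (by omega), hP j (by omega)]
    exact h4 _ _ hi hj

theorem IsZigzagPath.exists_hasBorderedCycle {V : Type*} [LinearOrder V] {G : SimpleGraph V}
    {k : ℕ} {p q : Fin (k + 2) → V} (hp : IsZigzagPath G p) (hq : IsZigzagPath G q)
    (h0 : p 0 = q 0) (h1 : p 1 ≠ q 1) (hlast : p (Fin.last (k + 1)) = q (Fin.last (k + 1))) :
    ∃ l, 2 ≤ l ∧ l ≤ k + 1 ∧ HasBorderedCycle G l := by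
  obtain ⟨P, hPp, hPadj, hPe, hPo, hPlr⟩ := hp.exists_seq
  obtain ⟨Q, hQq, hQadj, hQe, hQo, hQlr⟩ := hq.exists_seq
  have e0 : P 0 = Q 0 := by simpa [← hPp, ← hQq] using h0
  have e1 : P 1 ≠ Q 1 := by simpa [← hPp, ← hQq] using h1
  have ek : P (k + 1) = Q (k + 1) := by simpa [← hPp, ← hQq] using hlast
  clear hp hq h0 h1 hlast hPp hQq
  classical
  have hex : ∃ r, 0 < r ∧ ∃ w, 0 < w ∧ w ≤ k + 1 ∧ P r = Q w :=
    ⟨k + 1, by omega, k + 1, by omega, le_rfl, ek⟩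
  obtain ⟨r, ⟨hr0, w, hw0, hwk, hrw⟩, hrmin, hrk⟩ :
      ∃ r, (0 < r ∧ ∃ w, 0 < w ∧ w ≤ k + 1 ∧ P r = Q w) ∧
        (∀ i < r, 0 < i → ∀ j, 0 < j → j ≤ k + 1 → P i ≠ Q j) ∧ r ≤ k + 1 :=
    ⟨Nat.find hex, Nat.find_spec hex, fun i hi hi0 j hj hjk h =>
      Nat.find_min hex hi ⟨hi0, j, hj, hjk, h⟩,
      Nat.find_min' hex ⟨by omega, k + 1, by omega, le_rfl, ek⟩⟩
  have hPe' : ∀ i j, Even i → Even j → i ≤ j → j ≤ k + 1 → P j ≤ P i := fun i j hi hj hij hk =>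
    hij.eq_or_lt.elim (fun h => h ▸ le_rfl) fun h => (hPe i j hi hj h hk).le
  have hPo' : ∀ i j, Odd i → Odd j → i ≤ j → j ≤ k + 1 → P i ≤ P j := fun i j hi hj hij hk =>
    hij.eq_or_lt.elim (fun h => h ▸ le_rfl) fun h => (hPo i j hi hj h hk).le
  have hQe' : ∀ i j, Even i → Even j → i ≤ j → j ≤ k + 1 → Q j ≤ Q i := fun i j hi hj hij hk =>
    hij.eq_or_lt.elim (fun h => h ▸ le_rfl) fun h => (hQe i j hi hj h hk).le
  have hQo' : ∀ i j, Odd i → Odd j → i ≤ j → j ≤ k + 1 → Q i ≤ Q j := fun i j hi hj hij hk =>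
    hij.eq_or_lt.elim (fun h => h ▸ le_rfl) fun h => (hQo i j hi hj h hk).le
  have hPQ : ∀ i j, Even i → Odd j → i ≤ k + 1 → j ≤ k + 1 → P i < Q j := fun i j hi hj hik hjk =>
    ((hPe' 0 i (by simp) hi (by omega) hik).trans_eq e0).trans_lt
      (hQlr 0 j (by simp) hj (by omega) hjk)
  have hQP : ∀ i j, Even i → Odd j → i ≤ k + 1 → j ≤ k + 1 → Q i < P j := fun i j hi hj hik hjk =>
    ((hQe' 0 i (by simp) hi (by omega) hik).trans_eq e0.symm).trans_lt
      (hPlr 0 j (by simp) hj (by omega) hjk)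
  have injOf : ∀ R : ℕ → V, (∀ i j, Even i → Even j → i < j → j ≤ k + 1 → R j < R i) →
      (∀ i j, Odd i → Odd j → i < j → j ≤ k + 1 → R i < R j) →
      (∀ i j, Even i → Odd j → i ≤ k + 1 → j ≤ k + 1 → R i < R j) →
      ∀ i ≤ k + 1, ∀ j ≤ k + 1, R i = R j → i = j := by
    intro R he ho hlr i hi j hj h
    rcases Nat.even_or_odd i with ei | oi <;> rcases Nat.even_or_odd j with ej | oj
    · rcases lt_trichotomy i j with hij | hij | hij
      · exact absurd h (he i j ei ej hij hj).ne'
      · exact hij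
      · exact absurd h (he j i ej ei hij hi).ne
    · exact absurd h (hlr i j ei oj hi hj).ne
    · exact absurd h (hlr j i ej oi hj hi).ne'
    · rcases lt_trichotomy i j with hij | hij | hij
      · exact absurd h (ho i j oi oj hij hj).ne
      · exact hij
      · exact absurd h (ho j i oj oi hij hi).ne'
  have hPinj := injOf P hPe hPo hPlr
  have hQinj := injOf Q hQe hQo hQlr
  have hpar : Even r ↔ Even w := by
    constructor
    · intro hr
      by_contra hw
      exact (hPQ r w hr (Nat.not_even_iff_odd.1 hw) hrk hwk).ne hrw
    · intro hw
      by_contra hr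
      exact (hQP w r hw (Nat.not_even_iff_odd.1 hr) hwk hrk).ne' hrw
  obtain ⟨l, hl⟩ : ∃ l, r + w = 2 * l := by
    have : Even (r + w) := Nat.even_add.2 hpar
    exact this.exists_two_nsmul
  have hne : ¬ (r = 1 ∧ w = 1) := by
    rintro ⟨rfl, rfl⟩
    exact e1 hrw
  have hl2 : 2 ≤ l := by omega
  refine ⟨l, hl2, by omega, ?_⟩
  set d : ℕ → V := fun t => if t ≤ r then P t else Q (2 * l - t) with hd
  have dP : ∀ t ≤ r, d t = P t := fun t ht => if_pos ht
  have dQ : ∀ t, r ≤ t → d t = Q (2 * l - t) := fun t ht => by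
    rcases ht.eq_or_lt with rfl | ht
    · rw [dP r le_rfl, hrw]
      congr 1
      omega
    · exact if_neg (by omega)
  have parity : ∀ t ≤ 2 * l, (Even (2 * l - t) ↔ Even t) := fun t ht => by
    rw [Nat.even_sub ht]; simp
  have parity' : ∀ t ≤ 2 * l, (Odd (2 * l - t) ↔ Odd t) := fun t ht => by
    rw [← Nat.not_even_iff_odd, parity t ht, Nat.not_even_iff_odd]
  refine HasBorderedCycle.of_closed (d := d) hl2 ?_ ?_ ?_ ?_ ?_ ?_
  · rw [dP 0 (by omega), dQ (2 * l) (by omega), Nat.sub_self, e0]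
  · intro t ht
    rcases lt_or_ge t r with h | h
    · rw [dP t h.le, dP (t + 1) h]
      exact hPadj t (by omega)
    · rw [dQ t h, dQ (t + 1) (by omega)]
      have := (hQadj (2 * l - (t + 1)) (by omega)).symm
      rwa [show 2 * l - (t + 1) + 1 = 2 * l - t by omega] at this
  · have key : ∀ s t, s ≤ r → r < t → t < 2 * l → d s ≠ d t := by
      intro s t hs ht htl h
      rw [dP s hs, dQ t ht.le] at h
      rcases Nat.eq_zero_or_pos s with rfl | hs0
      · rw [e0] at h
        have := hQinj _ (by omega) _ (by omega) h
        omega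
      rcases hs.eq_or_lt with rfl | hs
      · rw [hrw] at h
        have := hQinj _ (by omega) _ (by omega) h
        omega
      · exact hrmin s hs hs0 _ (by omega) (by omega) h
    intro s hs t ht h
    rcases le_or_gt s r with hsr | hsr <;> rcases le_or_gt t r with htr | htr
    · rw [dP s hsr, dP t htr] at h
      exact hPinj _ (by omega) _ (by omega) h
    · exact absurd h (key s t hsr htr ht)
    · exact absurd h.symm (key t s htr hsr hs)
    · rw [dQ s hsr.le, dQ t htr.le] at h
      have := hQinj _ (by omega) _ (by omega) h
      omega
  · intro s hs t ht es ot
    rcases le_or_gt s r with hsr | hsr <;> rcases le_or_gt t r with htr | htr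
    · rw [dP s hsr, dP t htr]
      exact hPlr _ _ es ot (by omega) (by omega)
    · rw [dP s hsr, dQ t htr.le]
      exact hPQ _ _ es ((parity' t ht).2 ot) (by omega) (by omega)
    · rw [dQ s hsr.le, dP t htr]
      exact hQP _ _ ((parity s hs).2 es) ot (by omega) (by omega)
    · rw [dQ s hsr.le, dQ t htr.le]
      exact hQlr _ _ ((parity s hs).2 es) ((parity' t ht).2 ot) (by omega) (by omega)
  · rcases Nat.even_or_odd r with hr | hr
    · have hw := hpar.1 hr
      have hr2 : 2 ≤ r := by obtain ⟨c, rfl⟩ := hr; omega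
      have hw2 : 2 ≤ w := by obtain ⟨c, rfl⟩ := hw; omega
      have hmin : ∀ s ≤ 2 * l, Even s → d r ≤ d s := by
        intro s hs es
        rcases le_or_gt s r with hsr | hsr
        · rw [dP r le_rfl, dP s hsr]
          exact hPe' _ _ es hr hsr hrk
        · rw [dP r le_rfl, hrw, dQ s hsr.le]
          exact hQe' _ _ ((parity s hs).2 es) hw (by omega) hwk
      have hr1 : Odd (r - 1) := Nat.Even.sub_odd (by omega) hr odd_one
      have hw1 : Odd (w - 1) := Nat.Even.sub_odd (by omega) hw odd_one
      have hmax : ∀ s ≤ 2 * l, Odd s → d s ≤ d (r - 1) ∨ d s ≤ d (r + 1) := by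
        intro s hs os
        rcases le_or_gt s r with hsr | hsr
        · left
          rw [dP s hsr, dP (r - 1) (by omega)]
          have : s ≠ r := by rintro rfl; exact Nat.not_even_iff_odd.2 os hr
          exact hPo' _ _ os hr1 (by omega) (by omega)
        · right
          rw [dQ s hsr.le, dQ (r + 1) (by omega), show 2 * l - (r + 1) = w - 1 by omega]
          exact hQo' _ _ ((parity' s hs).2 os) hw1 (by omega) (by omega)
      rcases le_total (d (r - 1)) (d (r + 1)) with h | h
      · exact ⟨r, by omega, r + 1, by omega, hr.add_one, Or.inl rfl, hmin,
          fun s hs os => (hmax s hs os).elim (fun h' => h'.trans h) id⟩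
      · exact ⟨r, by omega, r - 1, by omega, hr1, Or.inr (by omega), hmin,
          fun s hs os => (hmax s hs os).elim id fun h' => h'.trans h⟩
    · have hw : Odd w := by
        rw [← Nat.not_even_iff_odd, ← hpar, Nat.not_even_iff_odd]; exact hr
      have hmax : ∀ s ≤ 2 * l, Odd s → d s ≤ d r := by
        intro s hs os
        rcases le_or_gt s r with hsr | hsr
        · rw [dP r le_rfl, dP s hsr]
          exact hPo' _ _ os hr hsr hrk
        · rw [dP r le_rfl, hrw, dQ s hsr.le]
          exact hQo' _ _ ((parity' s hs).2 os) hw (by omega) hwk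
      have hr1 : Even (r - 1) := Nat.Odd.sub_odd hr odd_one
      have hw1 : Even (w - 1) := Nat.Odd.sub_odd hw odd_one
      have hmin : ∀ s ≤ 2 * l, Even s → d (r - 1) ≤ d s ∨ d (r + 1) ≤ d s := by
        intro s hs es
        rcases le_or_gt s r with hsr | hsr
        · left
          rw [dP s hsr, dP (r - 1) (by omega)]
          have : s ≠ r := by rintro rfl; exact Nat.not_even_iff_odd.2 hr es
          exact hPe' _ _ es hr1 (by omega) (by omega)
        · right
          rw [dQ s hsr.le, dQ (r + 1) (by omega), show 2 * l - (r + 1) = w - 1 by omega]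
          exact hQe' _ _ ((parity s hs).2 es) hw1 (by omega) (by omega)
      rcases le_total (d (r - 1)) (d (r + 1)) with h | h
      · exact ⟨r - 1, by omega, r, by omega, hr, Or.inl (by omega),
          fun s hs es => (hmin s hs es).elim id fun h' => h.trans h', hmax⟩
      · exact ⟨r + 1, by omega, r, by omega, hr, Or.inr rfl,
          fun s hs es => (hmin s hs es).elim (fun h' => h.trans h') id, hmax⟩
  · have d0 : d 0 = P 0 := dP 0 (by omega)
    have dl : d (2 * l) = P 0 := by rw [dQ _ (by omega), Nat.sub_self, e0]
    have d1 : d 1 = P 1 := dP 1 (by omega)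
    have dl1 : d (2 * l - 1) = Q 1 := by
      rw [dQ _ (by omega), show 2 * l - (2 * l - 1) = 1 by omega]
    have hmax : ∀ s ≤ 2 * l, Even s → d s ≤ P 0 := by
      intro s hs es
      rcases le_or_gt s r with hsr | hsr
      · rw [dP s hsr]
        exact hPe' _ _ (by simp) es (by omega) (by omega)
      · rw [e0, dQ s hsr.le]
        exact hQe' _ _ (by simp) ((parity s hs).2 es) (by omega) (by omega)
    have hmin : ∀ s ≤ 2 * l, Odd s → P 1 ≤ d s ∨ Q 1 ≤ d s := by
      intro s hs os
      rcases le_or_gt s r with hsr | hsr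
      · left
        rw [dP s hsr]
        exact hPo' _ _ odd_one os os.pos (by omega)
      · right
        rw [dQ s hsr.le]
        have os' := (parity' s hs).2 os
        exact hQo' _ _ odd_one os' os'.pos (by omega)
    rcases le_total (P 1) (Q 1) with h | h
    · exact ⟨0, by omega, 1, by omega, odd_one, Or.inl rfl, d0 ▸ hmax, fun s hs os =>
        d1 ▸ (hmin s hs os).elim id fun h' => h.trans h'⟩
    · exact ⟨2 * l, le_rfl, 2 * l - 1, by omega, (parity' 1 (by omega)).2 odd_one,
        Or.inr (by omega), dl ▸ hmax, fun s hs os =>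
        dl1 ▸ (hmin s hs os).elim (fun h' => h.trans h') id⟩

theorem IsZigzagPath.tail_orderDual {V : Type*} [LinearOrder V] {G : SimpleGraph V} {k : ℕ}
    {p : Fin (k + 2) → V} (hp : IsZigzagPath G p) :
    IsZigzagPath (V := Vᵒᵈ) G (k := k) (fun i => OrderDual.toDual (p i.succ)) := by
  obtain ⟨h1, h2, h3, h4⟩ := hp
  refine ⟨fun i => h1 i.succ, fun i j hi hj hij => ?_, fun i j hi hj hij => ?_,
    fun i j hi hj => ?_⟩
  · exact h3 i.succ j.succ (by simpa using hi.add_one) (by simpa using hj.add_one)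
      (Fin.succ_lt_succ_iff.2 hij)
  · exact h2 i.succ j.succ (by simpa using hi.add_one) (by simpa using hj.add_one)
      (Fin.succ_lt_succ_iff.2 hij)
  · exact h4 j.succ i.succ (by simpa using hj.add_one) (by simpa using hi.add_one)

theorem IsZigzagPath.eq_of_forall_not_hasBorderedCycle (k : ℕ) :
    ∀ {V : Type*} [LinearOrder V] {G : SimpleGraph V},
    (∀ l, 2 ≤ l → l ≤ k → ¬ HasBorderedCycle G l) →
    ∀ {p q : Fin (k + 1) → V}, IsZigzagPath G p → IsZigzagPath G q → p 0 = q 0 →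
    p (Fin.last k) = q (Fin.last k) → p = q := by
  induction k with
  | zero =>
    intro V _ G _ p q _ _ h0 _
    funext i
    rw [Fin.fin_one_eq_zero i, h0]
  | succ k ih =>
    intro V _ G hfree p q hp hq h0 hlast
    by_cases h1 : p 1 = q 1
    · have htail := ih (V := Vᵒᵈ) (G := G)
        (fun l hl hlk h => hfree l hl (by omega) h.of_orderDual)
        hp.tail_orderDual hq.tail_orderDual h1 hlast
      funext i
      refine Fin.cases h0 (fun j => ?_) i
      exact congrFun htail j
    · obtain ⟨l, hl, hlk, h⟩ := hp.exists_hasBorderedCycle hq h0 h1 hlast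
      exact absurd h (hfree l hl hlk)

/-- **Unique zigzag paths.** Let `k ≥ 2` and let `G` be an ordered graph containing no
bordered cycle of length `2 * l` for any `2 ≤ l ≤ k`.  Then for every pair of vertices
`x, y` there is at most one `k`-zigzag path in `G` from `x` to `y`. -/
theorem zigzag_path_unique {V : Type*} [LinearOrder V] (k : ℕ) (hk : 2 ≤ k)
    (G : SimpleGraph V)
    (hfree : ∀ l, 2 ≤ l → l ≤ k → ¬ HasBorderedCycle G l)
    (x y : V) (p q : Fin (k + 1) → V)
    (hp : IsZigzagPath G p) (hq : IsZigzagPath G q)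
    (hp0 : p 0 = x) (hpk : p (Fin.last k) = y)
    (hq0 : q 0 = x) (hqk : q (Fin.last k) = y) :
    p = q := by
  exact IsZigzagPath.eq_of_forall_not_hasBorderedCycle k hfree hp hq (hp0.trans hq0.symm)
    (hpk.trans hqk.symm)
end

section
/- For every integer m ≥ 2, setting k = (m−1)! + 1, there exists a constant C > 0 such that every ordered graph on n vertices containing no bordered cycle of length 2k has at most C · n^{1+1/m} edges. -/
open Set in
/-- `G` contains two disjoint paths, from `x` to `x'` and from `y` to `y'`, on `2 * k + 2` vertices
altogether, which together with the edges `x y` and `x' y'` form a bordered cycle with outer border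
`x y` and inner border `x' y'`.  The lists `P` and `Q` are the paths without their last vertices. -/
def BorderedLink {V : Type*} [LinearOrder V] (G : SimpleGraph V) (k : ℕ) (x y x' y' : V) : Prop :=
  G.Adj x y ∧ G.Adj x' y' ∧ uIcc x' y' ⊆ uIcc x y ∧ ∃ P Q : List V,
    P.head? = some x ∧ Q.head? = some y ∧
    (P ++ [x']).IsChain (fun s t => G.Adj s t ∧ uIcc x' y' ⊆ uIcc s t) ∧
    (Q ++ [y']).IsChain (fun s t => G.Adj s t ∧ uIcc x' y' ⊆ uIcc s t) ∧
    (P ++ Q).Nodup ∧ (∀ z ∈ P ++ Q, z ∈ uIcc x y ∧ z ∉ uIcc x' y') ∧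
    P.length + Q.length = 2 * k

namespace BorderedLink

variable {V : Type*} [LinearOrder V] {G H : SimpleGraph V} {k l : ℕ} {x y x' y' x'' y'' : V}

theorem mono (hGH : G ≤ H) (h : BorderedLink G k x y x' y') : BorderedLink H k x y x' y' := by
  obtain ⟨h1, h2, h3, P, Q, hP, hQ, cP, cQ, h4⟩ := h
  exact ⟨hGH h1, hGH h2, h3, P, Q, hP, hQ, cP.imp fun _ _ h => ⟨hGH h.1, h.2⟩,
    cQ.imp fun _ _ h => ⟨hGH h.1, h.2⟩, h4⟩

theorem symm (h : BorderedLink G k x y x' y') : BorderedLink G k y x y' x' := by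
  obtain ⟨h1, h2, h3, P, Q, hP, hQ, cP, cQ, hn, hm, hl⟩ := h
  refine ⟨h1.symm, h2.symm, ?_, Q, P, hQ, hP, ?_, ?_, ?_, ?_, by omega⟩
  · rwa [Set.uIcc_comm y, Set.uIcc_comm y']
  · simpa only [Set.uIcc_comm y'] using cQ
  · simpa only [Set.uIcc_comm y'] using cP
  · exact List.nodup_append_comm.1 hn
  · intro z hz
    rw [Set.uIcc_comm y, Set.uIcc_comm y']
    exact hm z (by simp only [List.mem_append] at hz ⊢; tauto)

theorem trans (h : BorderedLink G k x y x' y') (h' : BorderedLink G l x' y' x'' y'') :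
    BorderedLink G (k + l) x y x'' y'' := by
  obtain ⟨h1, h2, h3, P, Q, hP, hQ, cP, cQ, hn, hm, hl⟩ := h
  obtain ⟨h1', h2', h3', P', Q', hP', hQ', cP', cQ', hn', hm', hl'⟩ := h'
  obtain ⟨T, rfl⟩ : ∃ T, P' = x' :: T := by cases P' <;> simp_all
  obtain ⟨S, rfl⟩ : ∃ S, Q' = y' :: S := by cases Q' <;> simp_all
  refine ⟨h1, h2', h3'.trans h3, P ++ x' :: T, Q ++ y' :: S, by simp [hP], by simp [hQ], ?_, ?_, ?_,
    ?_, by simp at hl' ⊢; omega⟩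
  · rw [List.append_assoc, List.cons_append, List.isChain_split]
    exact ⟨cP.imp fun _ _ h => ⟨h.1, h3'.trans h.2⟩, cP'⟩
  · rw [List.append_assoc, List.cons_append, List.isChain_split]
    exact ⟨cQ.imp fun _ _ h => ⟨h.1, h3'.trans h.2⟩, cQ'⟩
  · have hd : (P ++ Q).Disjoint (x' :: T ++ y' :: S) := fun z hz hz' => (hm z hz).2 (hm' z hz').1
    have := hn.append hn' hd
    refine (List.Perm.nodup_iff ?_).1 this
    rw [← Multiset.coe_eq_coe]
    simp only [← Multiset.coe_add]
    abel
  · intro z hz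
    have : z ∈ P ++ Q ∨ z ∈ x' :: T ++ y' :: S := by
      simp only [List.mem_append] at hz ⊢; tauto
    rcases this with hz | hz
    · exact ⟨(hm z hz).1, fun h => (hm z hz).2 (h3' h)⟩
    · exact ⟨h3 (hm' z hz).1, (hm' z hz).2⟩

end BorderedLink

theorem hasBorderedCycle_of_alternating {V : Type*} [LinearOrder V] {G : SimpleGraph V} {m : ℕ}
    (A B : Fin (m + 2) → V) (hA : A.Injective) (hB : B.Injective) (hAB : ∀ s t, A s < B t)
    (h₁ : ∀ s, G.Adj (A s) (B s)) (h₂ : ∀ s, G.Adj (A (s + 1)) (B s))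
    (houter : ∃ r s, (r = s ∨ r = s + 1) ∧ ∀ t, A r ≤ A t ∧ B t ≤ B s)
    (hinner : ∃ r s, (r = s ∨ r = s + 1) ∧ ∀ t, A t ≤ A r ∧ B s ≤ B t) :
    HasBorderedCycle G (m + 2) := by
  have key : ∀ F : Fin (m + 2) → V, F.Injective → ∃ (u : Fin (m + 2) → V)
      (a : Equiv.Perm (Fin (m + 2))), StrictMono u ∧ ∀ s, u (a s) = F s := by
    intro F hF
    refine ⟨F ∘ Tuple.sort F, (Tuple.sort F)⁻¹, (Tuple.monotone_sort F).strictMono_of_injective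
      (hF.comp (Tuple.sort F).injective), fun s => by simp⟩
  obtain ⟨u, a, hu, hua⟩ := key A hA
  obtain ⟨v, b, hv, hvb⟩ := key B hB
  have bot : ∀ {u : Fin (m + 2) → V} {a : Equiv.Perm (Fin (m + 2))} {r}, StrictMono u →
      (∀ t, u (a r) ≤ u (a t)) → a r = 0 := by
    intro u a r hu h
    have := h (a⁻¹ 0)
    simpa [hu.le_iff_le] using this
  have top : ∀ {u : Fin (m + 2) → V} {a : Equiv.Perm (Fin (m + 2))} {r}, StrictMono u →
      (∀ t, u (a t) ≤ u (a r)) → a r = Fin.last _ := by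
    intro u a r hu h
    have := h (a⁻¹ (Fin.last _))
    simpa [hu.le_iff_le] using this
  refine ⟨_, _, m, rfl, u, v, a, b, hu, hv, ?_, ?_, ?_, ?_, ?_, rfl, rfl⟩
  · have := hAB (a⁻¹ (Fin.last _)) (b⁻¹ 0)
    simpa [← hua, ← hvb] using this
  · simpa [hua, hvb] using h₁
  · simpa [hua, hvb] using h₂
  · obtain ⟨r, s, hrs, h⟩ := houter
    simp only [← hua, ← hvb] at h
    have h0 := bot hu fun t => (h t).1
    have h1 := top hv fun t => (h t).2
    refine ⟨s, ?_⟩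
    rcases hrs with rfl | rfl <;> tauto
  · obtain ⟨r, s, hrs, h⟩ := hinner
    simp only [← hua, ← hvb] at h
    have h0 := top hu fun t => (h t).1
    have h1 := bot hv fun t => (h t).2
    refine ⟨s, ?_⟩
    rcases hrs with rfl | rfl <;> tauto

theorem max_le_of_uIcc_subset_uIcc {V : Type*} [LinearOrder V] {a b c d : V} (hab : a ≠ b)
    (h : Set.uIcc a b ⊆ Set.uIcc c d) (hc : c ≤ min a b) : max a b ≤ d := by
  have h1 := Set.mem_uIcc.1 (h Set.left_mem_uIcc)
  have h2 := Set.mem_uIcc.1 (h Set.right_mem_uIcc)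
  grind

theorem le_min_of_uIcc_subset_uIcc {V : Type*} [LinearOrder V] {a b c d : V} (hab : a ≠ b)
    (h : Set.uIcc a b ⊆ Set.uIcc c d) (hc : max a b ≤ c) : d ≤ min a b := by
  have h1 := Set.mem_uIcc.1 (h Set.left_mem_uIcc)
  have h2 := Set.mem_uIcc.1 (h Set.right_mem_uIcc)
  grind

theorem BorderedLink.hasBorderedCycle {V : Type*} [LinearOrder V] {G : SimpleGraph V} {m : ℕ}
    {x y x' y' : V} (h : BorderedLink G (m + 1) x y x' y') : HasBorderedCycle G (m + 2) := by
  wlog hxy : x < y generalizing x y x' y'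
  · exact this h.symm (lt_of_le_of_ne (not_lt.1 hxy) h.1.ne')
  obtain ⟨h1, h2, h3, P, Q, hP, hQ, cP, cQ, hn, hm, hl⟩ := h
  set R : V → V → Prop := fun s t => G.Adj s t ∧ Set.uIcc x' y' ⊆ Set.uIcc s t with hR
  set L : List V := (P ++ [x']) ++ (Q ++ [y']).reverse with hL
  have hlen : L.length = 2 * (m + 2) := by simp [hL]; omega
  have hchain : L.IsChain R := by
    rw [hL, List.isChain_append]
    refine ⟨cP, ?_, ?_⟩
    · rw [List.isChain_reverse]
      exact cQ.imp fun s t h => ⟨h.1.symm, by rw [Set.uIcc_comm t]; exact h.2⟩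
    · simp [hR, h2]
  have hnodup : L.Nodup := by
    have hx' : x' ∉ P ++ Q := fun h => (hm _ h).2 Set.left_mem_uIcc
    have hy' : y' ∉ P ++ Q := fun h => (hm _ h).2 Set.right_mem_uIcc
    have : (x' :: y' :: (P ++ Q)).Nodup := by
      simp only [List.nodup_cons, List.mem_cons]
      exact ⟨by simpa [h2.ne] using hx', hy', hn⟩
    refine (List.Perm.nodup_iff ?_).1 this
    rw [← Multiset.coe_eq_coe]
    simp only [hL, ← Multiset.coe_add, ← Multiset.cons_coe, Multiset.coe_reverse,
      ← Multiset.singleton_add, Multiset.coe_nil, add_zero]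
    abel
  have hmem : ∀ z ∈ L, x ≤ z ∧ z ≤ y := by
    intro z hz
    have : z ∈ Set.uIcc x y := by
      by_cases hz' : z ∈ P ++ Q
      · exact (hm z hz').1
      · have : z = x' ∨ z = y' := by
          simp [hL] at hz hz'; tauto
        rcases this with rfl | rfl
        · exact h3 Set.left_mem_uIcc
        · exact h3 Set.right_mem_uIcc
    rwa [Set.uIcc_of_lt hxy] at this
  have hstep : ∀ i (hi : i + 1 < L.length), R (L[i]) (L[i + 1]) :=
    List.isChain_iff_getElem.1 hchain
  have hL0 : L[0]'(by omega) = x := by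
    obtain ⟨T, rfl⟩ : ∃ T, P = x :: T := by cases P <;> simp_all
    simp [hL]
  have hLlast : L[2 * m + 3]'(by omega) = y := by
    obtain ⟨T, rfl⟩ : ∃ T, Q = y :: T := by cases Q <;> simp_all
    have : L = (P ++ [x'] ++ (T ++ [y']).reverse) ++ [y] := by simp [hL]
    have hl2 : (P ++ [x'] ++ (T ++ [y']).reverse).length = 2 * m + 3 := by
      simp at hl ⊢; omega
    simp only [this]
    rw [List.getElem_append_right (by omega)]
    simp
  have hpos : 0 < P.length := by cases P <;> simp_all
  have hp1 : P.length + 1 < L.length := by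
    have : 0 < Q.length := by cases Q <;> simp_all
    omega
  have hLx' : L[P.length] = x' := by simp [hL]
  have hLy' : L[P.length + 1] = y' := by simp [hL]
  have hside : ∀ i (hi : i < L.length), if Even i then L[i] ≤ min x' y' else max x' y' ≤ L[i] := by
    have hx' := Set.mem_Icc.1 (Set.uIcc_of_lt hxy ▸ h3 Set.left_mem_uIcc)
    have hy' := Set.mem_Icc.1 (Set.uIcc_of_lt hxy ▸ h3 Set.right_mem_uIcc)
    intro i
    induction i with
    | zero => intro _; simp [hL0, hx', hy']
    | succ i ih =>
      intro hi
      have h := ih (by omega)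
      have hs := (hstep i hi).2
      simp only [Nat.even_add_one]
      by_cases he : Even i
      · rw [if_pos he] at h
        rw [if_neg (not_not.2 he)]
        exact max_le_of_uIcc_subset_uIcc h2.ne hs h
      · rw [if_neg he] at h
        rw [if_pos he]
        exact le_min_of_uIcc_subset_uIcc h2.ne hs h
  let A : Fin (m + 2) → V := fun s => L[2 * s.1]'(by omega)
  let B : Fin (m + 2) → V := fun s => L[2 * s.1 + 1]'(by omega)
  have hAlo : ∀ s, A s ≤ min x' y' := fun s => by
    simpa using hside (2 * s.1) (by omega)
  have hBhi : ∀ s, max x' y' ≤ B s := fun s => by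
    simpa using hside (2 * s.1 + 1) (by omega)
  have hlt : min x' y' < max x' y' := by simpa using h2.ne'
  refine hasBorderedCycle_of_alternating A B ?_ ?_ (fun s t => (hAlo s).trans_lt (hlt.trans_le (hBhi t)))
    ?_ ?_ ?_ ?_
  · intro s t hst
    have := (hnodup.getElem_inj_iff).1 hst
    exact Fin.ext (by omega)
  · intro s t hst
    have := (hnodup.getElem_inj_iff).1 hst
    exact Fin.ext (by omega)
  · intro s
    exact (hstep _ _).1
  · intro s
    by_cases hs : s = Fin.last _
    · subst hs
      simpa [A, B, hL0, Fin.val_last, hLlast, mul_add] using h1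
    · have hlt' : s < Fin.last _ := Fin.lt_last_iff_ne_last.2 hs
      have hs' : s.1 < m + 1 := hlt'
      have : (s + 1).1 = s.1 + 1 := Fin.val_add_one_of_lt hlt'
      have h := (hstep (2 * s.1 + 1) (by omega)).1.symm
      simpa [A, B, this, mul_add] using h
  · refine ⟨0, Fin.last _, Or.inr (by simp), fun t => ⟨?_, ?_⟩⟩
    · simpa [A, hL0] using (hmem _ (List.getElem_mem _)).1
    · simpa [B, hLlast, mul_add] using (hmem _ (List.getElem_mem _)).2
  · rcases Nat.even_or_odd' P.length with ⟨c, hc | hc⟩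
    · refine ⟨⟨c, by omega⟩, ⟨c, by omega⟩, Or.inl rfl, fun t => ⟨?_, ?_⟩⟩
      · have : A ⟨c, by omega⟩ = x' := by simp only [A, ← hc, hLx']
        rw [this]; exact (hAlo t).trans (min_le_left _ _)
      · have : B ⟨c, by omega⟩ = y' := by simp only [B, ← hc, hLy']
        rw [this]; exact (le_max_right _ _).trans (hBhi t)
    · have hlt : c < m + 1 := by omega
      refine ⟨⟨c + 1, by omega⟩, ⟨c, by omega⟩, Or.inr ?_, fun t => ⟨?_, ?_⟩⟩
      · ext
        rw [Fin.val_add_one_of_lt]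
        exact hlt
      · have : A ⟨c + 1, by omega⟩ = y' := by
          have : 2 * (c + 1) = P.length + 1 := by omega
          simp only [A, this, hLy']
        rw [this]; exact (hAlo t).trans (min_le_right _ _)
      · have : B ⟨c, by omega⟩ = x' := by simp only [B, ← hc, hLx']
        rw [this]; exact (le_max_left _ _).trans (hBhi t)

/-- A walk `f 0, f 1, …, f m` whose edges span strictly nested intervals, starting at the left end
of its first edge. -/
structure IsNestedWalk {V : Type*} [LinearOrder V] (G : SimpleGraph V) (f : ℕ → V) (m : ℕ) :
    Prop where
  adj : ∀ i < m, G.Adj (f i) (f (i + 1))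
  lt : ∀ i j, i < j → j ≤ m → Even i → f i < f j
  gt : ∀ i j, i < j → j ≤ m → ¬ Even i → f j < f i

namespace IsNestedWalk

variable {V : Type*} [LinearOrder V] {G : SimpleGraph V} {f g : ℕ → V} {m i j t : ℕ}

theorem ne (hf : IsNestedWalk G f m) (hij : i ≠ j) (hi : i ≤ m) (hj : j ≤ m) : f i ≠ f j := by
  have h1 := hf.lt i j
  have h2 := hf.gt i j
  have h3 := hf.lt j i
  have h4 := hf.gt j i
  grind

theorem mem_uIcc (hf : IsNestedWalk G f m) (_ : i < m) (hit : i ≤ t) (ht : t ≤ m) :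
    f t ∈ Set.uIcc (f i) (f (i + 1)) := by
  have h1 := hf.lt i t
  have h2 := hf.gt i t
  have h3 := hf.lt (i + 1) t
  have h4 := hf.gt (i + 1) t
  have h5 := hf.lt i (i + 1)
  have h6 := hf.gt i (i + 1)
  rw [Set.mem_uIcc]
  rw [Nat.even_add_one] at h3 h4
  grind

theorem notMem_uIcc (hf : IsNestedWalk G f m) (hit : t < i) (hi : i < m) :
    f t ∉ Set.uIcc (f i) (f (i + 1)) := by
  have h1 := hf.lt t i
  have h2 := hf.gt t i
  have h3 := hf.lt t (i + 1)
  have h4 := hf.gt t (i + 1)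
  rw [Set.mem_uIcc]
  grind

theorem uIcc_subset (hf : IsNestedWalk G f m) (hij : i ≤ j) (hj : j < m) :
    Set.uIcc (f j) (f (j + 1)) ⊆ Set.uIcc (f i) (f (i + 1)) :=
  Set.uIcc_subset_uIcc (hf.mem_uIcc (by omega) hij (by omega))
    (hf.mem_uIcc (by omega) (by omega) (by omega))

end IsNestedWalk

theorem isChain_map_range' {V : Type*} {R : V → V → Prop} {f : ℕ → V} {a n : ℕ}
    (h : ∀ i, a ≤ i → i < a + n → R (f i) (f (i + 1))) :
    ((List.range' a n).map f ++ [f (a + n)]).IsChain R := by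
  have : (List.range' a n).map f ++ [f (a + n)] = (List.range' a (n + 1)).map f := by
    simp [List.range'_concat]
  rw [this, List.isChain_map, List.isChain_iff_getElem]
  intro i hi
  simp only [List.length_range'] at hi
  simp only [List.getElem_range', one_mul]
  exact h (a + i) (by omega) (by omega)

/-- Two nested walks that part at the common vertex `f i = g i`, and meet again for the first time
at `f s = g j`, bound a bordered cycle. -/
theorem IsNestedWalk.exists_borderedLink_of_disjoint {V : Type*} [LinearOrder V]
    {G : SimpleGraph V} {f g : ℕ → V} {m i s j : ℕ} (hf : IsNestedWalk G f m)
    (hg : IsNestedWalk G g m) (his : i < s) (hs : s ≤ m) (hij : i < j) (hj : j ≤ m)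
    (hpar : Even s ↔ Even j) (h0 : f i = g i) (hne : f (i + 1) ≠ g (i + 1)) (hmeet : f s = g j)
    (hdisj : ∀ s' j', i < s' → s' < s → i < j' → j' < j → f s' ≠ g j')
    (houter : g (i + 1) ∈ Set.uIcc (f i) (f (i + 1))) :
    ∃ k x y x' y', 1 ≤ k ∧ k < m ∧ BorderedLink G k x y x' y' := by
  obtain ⟨s, rfl⟩ : ∃ s', s = s' + 1 := ⟨s - 1, by omega⟩
  obtain ⟨j, rfl⟩ : ∃ j', j = j' + 1 := ⟨j - 1, by omega⟩
  have hsub : Set.uIcc (g i) (g (i + 1)) ⊆ Set.uIcc (f (i + 1)) (f i) := by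
    rw [Set.uIcc_comm (f (i + 1))]
    exact Set.uIcc_subset_uIcc (by simp [h0]) houter
  have hfout : f (i + 1) ∉ Set.uIcc (g i) (g (i + 1)) := by
    intro h
    rw [← h0] at h
    exact hne (Set.eq_of_mem_uIcc_of_mem_uIcc' h houter)
  have hs1 : i + 1 < s + 1 := by
    by_contra h
    obtain rfl : s = i := by omega
    rw [hmeet] at hfout
    exact hfout (hg.mem_uIcc (by omega) (by omega) hj)
  have hij2 : ∀ t, t ≤ m → i ≤ t → f t ∈ Set.uIcc (f (i + 1)) (f i) := fun t ht hit => by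
    rw [Set.uIcc_comm]; exact hf.mem_uIcc (by omega) hit ht
  have hij3 : ∀ t, t ≤ m → i ≤ t → g t ∈ Set.uIcc (f (i + 1)) (f i) := fun t ht hit =>
    hsub (hg.mem_uIcc (by omega) hit ht)
  have hinner : g j ∈ Set.uIcc (f s) (f (s + 1)) ∨ f s ∈ Set.uIcc (g j) (g (j + 1)) := by
    have h1 := hf.lt s (s + 1)
    have h2 := hf.gt s (s + 1)
    have h3 := hg.lt j (j + 1)
    have h4 := hg.gt j (j + 1)
    rw [Nat.even_add_one, Nat.even_add_one] at hpar
    rw [Set.mem_uIcc, Set.mem_uIcc]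
    grind
  have hfs : f s ≠ g j := by
    rcases (show j = i ∨ i < j by omega) with rfl | h
    · rw [← h0]
      exact hf.ne (by omega) (by omega) (by omega)
    · exact hdisj s j (by omega) (by omega) h (by omega)
  have hpar2 : ∃ c, s + j = 2 * c := by
    rw [Nat.even_iff, Nat.even_iff] at hpar
    exact ⟨(s + j) / 2, by omega⟩
  obtain ⟨c, hc⟩ := hpar2
  have hnodup : ∀ a n b l, i < a → a + n ≤ s + 1 → i ≤ b → b + l ≤ j + 1 →
      ((List.range' a n).map f ++ (List.range' b l).map g).Nodup := by
    intro a n b l ha han hb hbl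
    refine List.Nodup.append ?_ ?_ ?_
    · refine List.Nodup.map_on (fun u hu v hv huv => ?_) List.nodup_range'
      rw [List.mem_range'_1] at hu hv
      by_contra h
      exact hf.ne h (by omega) (by omega) huv
    · refine List.Nodup.map_on (fun u hu v hv huv => ?_) List.nodup_range'
      rw [List.mem_range'_1] at hu hv
      by_contra h
      exact hg.ne h (by omega) (by omega) huv
    · intro z hz hz'
      rw [List.mem_map] at hz hz'
      obtain ⟨u, hu, rfl⟩ := hz
      obtain ⟨v, hv, hvu⟩ := hz'
      rw [List.mem_range'_1] at hu hv
      rcases (show v = i ∨ i < v by omega) with rfl | h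
      · rw [← h0] at hvu
        exact hf.ne (by omega) (by omega) (by omega) hvu
      · exact hdisj u v (by omega) (by omega) h (by omega) hvu.symm
  rcases hinner with hinner | hinner
  · have hj1 : i < j := by
      by_contra h
      obtain rfl : j = i := by omega
      rw [← h0] at hinner
      exact hf.notMem_uIcc (by omega) (by omega) hinner
    have hsub' : Set.uIcc (g j) (g (j + 1)) ⊆ Set.uIcc (f s) (f (s + 1)) :=
      Set.uIcc_subset_uIcc hinner (by simp [← hmeet])
    have hsnot : f s ∉ Set.uIcc (g j) (g (j + 1)) := fun h =>
      hfs (Set.eq_of_mem_uIcc_of_mem_uIcc' (a := g (j + 1)) (by rwa [Set.uIcc_comm, ← hmeet])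
        (by rwa [Set.uIcc_comm])).symm
    refine ⟨c - i, f (i + 1), g i, f (s + 1), g j, by omega, by omega, ?_, ?_, ?_,
      (List.range' (i + 1) (s - i)).map f, (List.range' i (j - i)).map g, ?_, ?_, ?_, ?_, ?_, ?_, ?_⟩
    · rw [← h0]; exact (hf.adj _ (by omega)).symm
    · rw [hmeet]; exact (hg.adj _ (by omega)).symm
    · rw [← h0]
      exact Set.uIcc_subset_uIcc (hij2 _ (by omega) (by omega)) (hij3 _ (by omega) (by omega))
    · obtain ⟨d, hd⟩ : ∃ d, s - i = d + 1 := ⟨s - i - 1, by omega⟩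
      simp [hd, List.range'_succ]
    · obtain ⟨d, hd⟩ : ∃ d, j - i = d + 1 := ⟨j - i - 1, by omega⟩
      simp [hd, List.range'_succ]
    · have := isChain_map_range' (R := fun a b => G.Adj a b ∧
          Set.uIcc (f (s + 1)) (g j) ⊆ Set.uIcc a b) (f := f) (a := i + 1) (n := s - i) ?_
      · rwa [show i + 1 + (s - i) = s + 1 by omega] at this
      · intro t ht ht'
        refine ⟨hf.adj _ (by omega), ?_⟩
        rw [Set.uIcc_comm, hmeet]
        exact hsub'.trans (hf.uIcc_subset (by omega) (by omega))
    · have := isChain_map_range' (R := fun a b => G.Adj a b ∧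
          Set.uIcc (f (s + 1)) (g j) ⊆ Set.uIcc a b) (f := g) (a := i) (n := j - i) ?_
      · rwa [show i + (j - i) = j by omega] at this
      · intro t ht ht'
        refine ⟨hg.adj _ (by omega), ?_⟩
        rw [Set.uIcc_comm, hmeet]
        exact hg.uIcc_subset (by omega) (by omega)
    · exact hnodup _ _ _ _ (by omega) (by omega) (by omega) (by omega)
    · intro z hz
      simp only [List.mem_append, List.mem_map, List.mem_range'_1] at hz
      rw [← h0, hmeet, Set.uIcc_comm (g (j + 1))]
      rcases hz with ⟨t, ht, rfl⟩ | ⟨t, ht, rfl⟩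
      · refine ⟨hij2 _ (by omega) (by omega), fun h => ?_⟩
        rcases (show t = s ∨ t < s by omega) with rfl | h'
        · exact hsnot h
        · exact hf.notMem_uIcc h' (by omega) (hsub' h)
      · exact ⟨hij3 _ (by omega) (by omega), hg.notMem_uIcc (by omega) (by omega)⟩
    · simp; omega
  · have hs2 : i + 1 < s := by
      by_contra h
      obtain rfl : s = i + 1 := by omega
      exact hfout (hg.uIcc_subset (by omega) (by omega) hinner)
    have hsub' : Set.uIcc (f s) (f (s + 1)) ⊆ Set.uIcc (g j) (g (j + 1)) :=
      Set.uIcc_subset_uIcc hinner (by simp [hmeet])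
    have hjnot : g j ∉ Set.uIcc (f s) (f (s + 1)) := fun h =>
      hfs (Set.eq_of_mem_uIcc_of_mem_uIcc' (a := g (j + 1)) (by rwa [Set.uIcc_comm])
        (by rwa [Set.uIcc_comm, ← hmeet]))
    refine ⟨c - i, f (i + 1), g i, f s, g (j + 1), by omega, by omega, ?_, ?_, ?_,
      (List.range' (i + 1) (s - i - 1)).map f, (List.range' i (j + 1 - i)).map g,
      ?_, ?_, ?_, ?_, ?_, ?_, ?_⟩
    · rw [← h0]; exact (hf.adj _ (by omega)).symm
    · rw [← hmeet]; exact hf.adj _ (by omega)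
    · rw [← h0]
      exact Set.uIcc_subset_uIcc (hij2 _ (by omega) (by omega)) (hij3 _ (by omega) (by omega))
    · obtain ⟨d, hd⟩ : ∃ d, s - i - 1 = d + 1 := ⟨s - i - 2, by omega⟩
      simp [hd, List.range'_succ]
    · obtain ⟨d, hd⟩ : ∃ d, j + 1 - i = d + 1 := ⟨j - i, by omega⟩
      simp [hd, List.range'_succ]
    · have := isChain_map_range' (R := fun a b => G.Adj a b ∧
          Set.uIcc (f s) (g (j + 1)) ⊆ Set.uIcc a b) (f := f) (a := i + 1) (n := s - i - 1) ?_
      · rwa [show i + 1 + (s - i - 1) = s by omega] at this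
      · intro t ht ht'
        refine ⟨hf.adj _ (by omega), ?_⟩
        rw [← hmeet]
        exact hf.uIcc_subset (by omega) (by omega)
    · have := isChain_map_range' (R := fun a b => G.Adj a b ∧
          Set.uIcc (f s) (g (j + 1)) ⊆ Set.uIcc a b) (f := g) (a := i) (n := j + 1 - i) ?_
      · rwa [show i + (j + 1 - i) = j + 1 by omega] at this
      · intro t ht ht'
        refine ⟨hg.adj _ (by omega), ?_⟩
        rw [← hmeet]
        exact hsub'.trans (hg.uIcc_subset (by omega) (by omega))
    · exact hnodup _ _ _ _ (by omega) (by omega) (by omega) (by omega)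
    · intro z hz
      simp only [List.mem_append, List.mem_map, List.mem_range'_1] at hz
      rw [← h0, ← hmeet]
      rcases hz with ⟨t, ht, rfl⟩ | ⟨t, ht, rfl⟩
      · exact ⟨hij2 _ (by omega) (by omega), hf.notMem_uIcc (by omega) (by omega)⟩
      · refine ⟨hij3 _ (by omega) (by omega), fun h => ?_⟩
        rcases (show t = j ∨ t < j by omega) with rfl | h'
        · exact hjnot h
        · exact hg.notMem_uIcc h' (by omega) (hsub' h)
    · simp; omega

theorem IsNestedWalk.exists_borderedLink {V : Type*} [LinearOrder V] {G : SimpleGraph V}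
    {f g : ℕ → V} {m : ℕ} (hf : IsNestedWalk G f m) (hg : IsNestedWalk G g m) (h0 : f 0 = g 0)
    (hm : f m = g m) (hne : ∃ i ≤ m, f i ≠ g i) :
    ∃ k x y x' y', 1 ≤ k ∧ k < m ∧ BorderedLink G k x y x' y' := by
  obtain ⟨i, hi, h0, hne⟩ : ∃ i < m, f i = g i ∧ f (i + 1) ≠ g (i + 1) := by
    by_contra! h
    obtain ⟨i, hi, hne⟩ := hne
    refine hne ?_
    clear hne
    induction i with
    | zero => exact h0
    | succ i ih => exact h i (by omega) (ih (by omega))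
  classical
  have hex : ∃ j, i < j ∧ j ≤ m ∧ ∃ s, i < s ∧ s ≤ m ∧ f s = g j :=
    ⟨m, hi, le_rfl, m, hi, le_rfl, hm⟩
  obtain ⟨hij, hj, s, his, hs, hmeet⟩ := Nat.find_spec hex
  have hmin := fun j' => Nat.find_min (m := j') hex
  generalize Nat.find hex = j at *
  have hdisj : ∀ s' j', i < s' → s' < s → i < j' → j' < j → f s' ≠ g j' :=
    fun s' j' h1 h2 h3 h4 h5 => hmin j' h4 ⟨h3, by omega, s', h1, by omega, h5⟩
  have hpar : Even s ↔ Even j := by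
    have h1 := hf.lt s m
    have h2 := hf.gt s m
    have h3 := hg.lt j m
    have h4 := hg.gt j m
    rcases eq_or_ne s m with rfl | hs' <;> rcases eq_or_ne j s with rfl | hj' <;> grind
  have houter : g (i + 1) ∈ Set.uIcc (f i) (f (i + 1)) ∨ f (i + 1) ∈ Set.uIcc (g i) (g (i + 1)) := by
    have h1 := hf.lt i (i + 1)
    have h2 := hf.gt i (i + 1)
    have h3 := hg.lt i (i + 1)
    have h4 := hg.gt i (i + 1)
    rw [Set.mem_uIcc, Set.mem_uIcc]
    grind
  rcases houter with houter | houter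
  · exact hf.exists_borderedLink_of_disjoint hg his hs hij hj hpar h0 hne hmeet hdisj houter
  · exact hg.exists_borderedLink_of_disjoint hf hij hj his hs hpar.symm h0.symm hne.symm hmeet.symm
      (fun s' j' h1 h2 h3 h4 => (hdisj j' s' h3 h4 h1 h2).symm) houter

/-- The edges of `G` from both of whose ends at least `D` edges of `G` leave strictly inwards. -/
def innerTrim {V : Type*} [LinearOrder V] (D : ℕ) (G : SimpleGraph V) : SimpleGraph V where
  Adj u v := G.Adj u v ∧ D ≤ {z | G.Adj v z ∧ (u < z ∧ z < v ∨ v < z ∧ z < u)}.ncard ∧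
    D ≤ {z | G.Adj u z ∧ (v < z ∧ z < u ∨ u < z ∧ z < v)}.ncard
  symm := ⟨fun _ _ h => ⟨h.1.symm, h.2.2, h.2.1⟩⟩
  loopless := ⟨fun _ h => h.1.ne rfl⟩

theorem innerTrim_le {V : Type*} [LinearOrder V] (D : ℕ) (G : SimpleGraph V) :
    innerTrim D G ≤ G := fun _ _ h => h.1

theorem iterate_innerTrim_le {V : Type*} [LinearOrder V] (D : ℕ) (G : SimpleGraph V) (j : ℕ) :
    (innerTrim D)^[j] G ≤ G := by
  induction j with
  | zero => exact le_rfl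
  | succ j ih => rw [Function.iterate_succ_apply']; exact (innerTrim_le _ _).trans ih

/-- The edges of an ordered graph as increasing pairs. -/
noncomputable def orderedEdges {V : Type*} [LinearOrder V] [Fintype V] (G : SimpleGraph V) :
    Finset (V × V) :=
  open scoped Classical in Finset.univ.filter fun p => p.1 < p.2 ∧ G.Adj p.1 p.2

theorem mem_orderedEdges {V : Type*} [LinearOrder V] [Fintype V] {G : SimpleGraph V} {p : V × V} :
    p ∈ orderedEdges G ↔ p.1 < p.2 ∧ G.Adj p.1 p.2 := by
  simp [orderedEdges]

theorem card_filter_card_gt_lt_le {V : Type*} [LinearOrder V] (S : Finset V) (D : ℕ) :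
    (S.filter fun a => (S.filter fun z => a < z).card < D).card ≤ D := by
  set T := S.filter fun a => (S.filter fun z => a < z).card < D with hT
  rcases T.eq_empty_or_nonempty with h | h
  · simp [h]
  · have hmin := Finset.min'_mem T h
    have h1 : T.erase (T.min' h) ⊆ S.filter fun z => T.min' h < z := by
      intro z hz
      have hzT := Finset.mem_of_mem_erase hz
      exact Finset.mem_filter.2 ⟨(Finset.mem_filter.1 hzT).1, Finset.min'_lt_of_mem_erase_min' T h hz⟩
    have h2 := Finset.card_le_card h1
    rw [Finset.card_erase_of_mem hmin] at h2
    have h3 := (Finset.mem_filter.1 hmin).2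
    omega

theorem card_filter_card_lt_lt_le {V : Type*} [LinearOrder V] (S : Finset V) (D : ℕ) :
    (S.filter fun a => (S.filter fun z => z < a).card < D).card ≤ D :=
  card_filter_card_gt_lt_le (V := Vᵒᵈ) S D

theorem card_orderedEdges_le_innerTrim {V : Type*} [LinearOrder V] [Fintype V] (D : ℕ)
    (G : SimpleGraph V) :
    (orderedEdges G).card ≤ (orderedEdges (innerTrim D G)).card + 2 * Fintype.card V * D := by
  classical
  let B₁ := (orderedEdges G).filter fun p =>
    ((Finset.univ.filter fun z => z < p.2 ∧ G.Adj z p.2).filter fun z => p.1 < z).card < D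
  let B₂ := (orderedEdges G).filter fun p =>
    ((Finset.univ.filter fun z => p.1 < z ∧ G.Adj p.1 z).filter fun z => z < p.2).card < D
  have h1 : B₁.card ≤ D * Fintype.card V := by
    refine Finset.card_le_mul_card_image_of_maps_to (f := Prod.snd) (t := Finset.univ)
      (fun _ _ => Finset.mem_univ _) D fun b _ => ?_
    refine le_trans ?_ (card_filter_card_gt_lt_le (Finset.univ.filter fun z => z < b ∧ G.Adj z b) D)
    refine Finset.card_le_card_of_injOn Prod.fst ?_ ?_
    · rintro ⟨p, q⟩ hp
      simp only [B₁, Finset.coe_filter, Set.mem_ofPred_eq, Finset.mem_filter, mem_orderedEdges] at hp ⊢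
      obtain ⟨⟨hp, hp'⟩, rfl⟩ := hp
      exact ⟨⟨Finset.mem_univ _, hp⟩, hp'⟩
    · rintro ⟨p, q⟩ hp ⟨p', q'⟩ hp' h
      simp only [Finset.coe_filter, Set.mem_ofPred_eq] at hp hp'
      exact Prod.ext h (hp.2.trans hp'.2.symm)
  have h2 : B₂.card ≤ D * Fintype.card V := by
    refine Finset.card_le_mul_card_image_of_maps_to (f := Prod.fst) (t := Finset.univ)
      (fun _ _ => Finset.mem_univ _) D fun b _ => ?_
    refine le_trans ?_ (card_filter_card_lt_lt_le (Finset.univ.filter fun z => b < z ∧ G.Adj b z) D)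
    refine Finset.card_le_card_of_injOn Prod.snd ?_ ?_
    · rintro ⟨p, q⟩ hp
      simp only [B₂, Finset.coe_filter, Set.mem_ofPred_eq, Finset.mem_filter, mem_orderedEdges] at hp ⊢
      obtain ⟨⟨hp, hp'⟩, rfl⟩ := hp
      exact ⟨⟨Finset.mem_univ _, hp⟩, hp'⟩
    · rintro ⟨p, q⟩ hp ⟨p', q'⟩ hp' h
      simp only [Finset.coe_filter, Set.mem_ofPred_eq] at hp hp'
      exact Prod.ext (hp.2.trans hp'.2.symm) h
  have h3 : orderedEdges G ⊆ orderedEdges (innerTrim D G) ∪ (B₁ ∪ B₂) := by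
    rintro ⟨a, b⟩ hp
    have hp' := mem_orderedEdges.1 hp
    simp only [Finset.mem_union, B₁, B₂, Finset.mem_filter, hp, true_and, mem_orderedEdges]
    by_contra! h
    obtain ⟨h4, h5, h6⟩ := h
    refine h4 hp'.1 ⟨hp'.2, h5.trans ?_, h6.trans ?_⟩
    · rw [← Set.ncard_coe_finset]
      refine Set.ncard_le_ncard (fun z hz => ?_) (Set.toFinite _)
      simp only [Finset.coe_filter, Set.mem_ofPred_eq, Finset.mem_filter] at hz ⊢
      exact ⟨hz.1.2.2.symm, Or.inl ⟨hz.2, hz.1.2.1⟩⟩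
    · rw [← Set.ncard_coe_finset]
      refine Set.ncard_le_ncard (fun z hz => ?_) (Set.toFinite _)
      simp only [Finset.coe_filter, Set.mem_ofPred_eq, Finset.mem_filter] at hz ⊢
      exact ⟨hz.1.2.2, Or.inr ⟨hz.1.2.1, hz.2⟩⟩
  calc _ ≤ _ := Finset.card_le_card h3
    _ ≤ _ := Finset.card_union_le _ _
    _ ≤ (orderedEdges (innerTrim D G)).card + (B₁.card + B₂.card) := by
      gcongr; exact Finset.card_union_le _ _
    _ ≤ _ := by nlinarith

theorem card_orderedEdges_le_iterate_innerTrim {V : Type*} [LinearOrder V] [Fintype V] (D : ℕ)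
    (G : SimpleGraph V) (j : ℕ) :
    (orderedEdges G).card ≤
      (orderedEdges ((innerTrim D)^[j] G)).card + j * (2 * Fintype.card V * D) := by
  induction j with
  | zero => simp
  | succ j ih =>
    have := card_orderedEdges_le_innerTrim D ((innerTrim D)^[j] G)
    rw [Function.iterate_succ_apply']
    linarith

theorem exists_borderedLink_of_card_lt {V : Type*} [LinearOrder V] [Fintype V]
    (G : SimpleGraph V) (m D : ℕ) (hD : Fintype.card V < D ^ m)
    (hG : m * (2 * Fintype.card V * D) < (orderedEdges G).card) :
    ∃ k x y x' y', 1 ≤ k ∧ k < m ∧ BorderedLink G k x y x' y' := by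
  classical
  have hnext : ∀ (j : ℕ) (u v : V), ∃ c : Fin D → V, ((innerTrim D)^[j + 1] G).Adj u v →
      c.Injective ∧ ∀ t, ((innerTrim D)^[j] G).Adj v (c t) ∧
        (u < c t ∧ c t < v ∨ v < c t ∧ c t < u) := by
    intro j u v
    by_cases h : ((innerTrim D)^[j + 1] G).Adj u v
    · rw [Function.iterate_succ_apply'] at h
      have hcard := h.2.1
      rw [Set.ncard_eq_toFinset_card _ (Set.toFinite _)] at hcard
      obtain ⟨T, hT, hTD⟩ := Finset.exists_subset_card_eq hcard
      refine ⟨fun t => (T.equivFinOfCardEq hTD).symm t, fun _ => ⟨?_, fun t => ?_⟩⟩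
      · exact Subtype.val_injective.comp (Equiv.injective _)
      · have := hT ((T.equivFinOfCardEq hTD).symm t).2
        simpa using this
    · exact ⟨fun _ => u, fun h' => absurd h' h⟩
  choose c hc using hnext
  obtain ⟨⟨x₀, y₀⟩, h0⟩ : (orderedEdges ((innerTrim D)^[m] G)).Nonempty := by
    rw [← Finset.card_pos]
    have := card_orderedEdges_le_iterate_innerTrim D G m
    omega
  obtain ⟨hlt, hadj⟩ := mem_orderedEdges.1 h0
  let F : (Fin m → Fin D) → ℕ → V × V := fun s i => Nat.rec (y₀, x₀)
    (fun i e => if hi : i < m then (e.2, c (m - (i + 1)) e.1 e.2 (s ⟨i, hi⟩)) else e) i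
  have F0 : ∀ s, F s 0 = (y₀, x₀) := fun s => rfl
  have F1 : ∀ s i (hi : i < m), F s (i + 1) =
      ((F s i).2, c (m - (i + 1)) (F s i).1 (F s i).2 (s ⟨i, hi⟩)) :=
    fun s i hi => dif_pos hi
  have Fadj : ∀ s i, i ≤ m → ((innerTrim D)^[m - i] G).Adj (F s i).1 (F s i).2 := by
    intro s i
    induction i with
    | zero => intro _; simpa [F0] using hadj.symm
    | succ i ih =>
      intro hi
      have h := ih (by omega)
      rw [show m - i = m - (i + 1) + 1 by omega] at h
      rw [F1 s i hi]
      exact ((hc _ _ _ h).2 _).1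
  have Fbetween : ∀ s i (hi : i < m),
      (F s i).1 < (F s (i + 1)).2 ∧ (F s (i + 1)).2 < (F s i).2 ∨
        (F s i).2 < (F s (i + 1)).2 ∧ (F s (i + 1)).2 < (F s i).1 := by
    intro s i hi
    have h := Fadj s i hi.le
    rw [show m - i = m - (i + 1) + 1 by omega] at h
    rw [F1 s i hi]
    exact ((hc _ _ _ h).2 _).2
  have Fside : ∀ s i, i ≤ m → if Even i then (F s i).2 < (F s i).1 else (F s i).1 < (F s i).2 := by
    intro s i
    induction i with
    | zero => intro _; simpa [F0] using hlt
    | succ i ih =>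
      intro hi
      have h := ih (by omega)
      have h' := Fbetween s i hi
      have h1 : (F s (i + 1)).1 = (F s i).2 := by rw [F1 s i hi]
      rw [h1]
      simp only [Nat.even_add_one]
      grind
  have hwalk : ∀ s, IsNestedWalk G (fun i => (F s i).2) m := by
    intro s
    have hord : ∀ i j, i < j → j ≤ m →
        if Even i then (F s i).2 ≤ (F s j).1 ∧ (F s i).2 < (F s j).2
        else (F s j).1 ≤ (F s i).2 ∧ (F s j).2 < (F s i).2 := by
      intro i j hij
      induction j, hij using Nat.le_induction with
      | base =>
        intro hi
        have h := Fside s i (by omega)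
        have h' := Fbetween s i hi
        have h1 : (F s (i + 1)).1 = (F s i).2 := by rw [F1 s i hi]
        grind
      | succ j hij ih =>
        intro hj
        have h := ih (by omega)
        have h' := Fbetween s j hj
        have h1 : (F s (j + 1)).1 = (F s j).2 := by rw [F1 s j hj]
        grind
    refine ⟨fun i hi => ?_, fun i j hij hj he => ?_, fun i j hij hj he => ?_⟩
    · have := iterate_innerTrim_le _ _ _ (Fadj s (i + 1) hi)
      rwa [F1 s i hi] at this ⊢
    · have := hord i j hij hj
      rw [if_pos he] at this
      exact this.2
    · have := hord i j hij hj
      rw [if_neg he] at this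
      exact this.2
  obtain ⟨s, t, hst, hend⟩ := Fintype.exists_ne_map_eq_of_card_lt
    (fun s : Fin m → Fin D => (F s m).2) (by simpa using hD)
  refine (hwalk s).exists_borderedLink (hwalk t) rfl hend ?_
  by_contra! h
  refine hst ?_
  have hF : ∀ i ≤ m, F s i = F t i := by
    intro i hi
    refine Prod.ext ?_ (h i hi)
    cases i with
    | zero => rfl
    | succ i => rw [F1 s i hi, F1 t i hi]; exact h i (by omega)
  funext i
  have h1 := F1 s i i.2
  have h2 := F1 t i i.2
  rw [hF (i + 1) i.2, hF i i.2.le, h2] at h1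
  have h3 := Fadj t i i.2.le
  rw [show m - i.1 = m - (i.1 + 1) + 1 by omega] at h3
  exact ((hc _ _ _ h3).1 (Prod.ext_iff.1 h1).2).symm

/-- There are `j` links of order `k`, each starting at the inner border of the previous one, the
first of them starting at `x`, `y`. -/
def HasLinkChain {V : Type*} [LinearOrder V] (G : SimpleGraph V) (k : ℕ) : ℕ → V → V → Prop
  | 0, _, _ => True
  | j + 1, x, y => ∃ x' y', BorderedLink G k x y x' y' ∧ HasLinkChain G k j x' y'

namespace HasLinkChain

variable {V : Type*} [LinearOrder V] {G : SimpleGraph V} {k j : ℕ} {x y : V}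

theorem symm (h : HasLinkChain G k j x y) : HasLinkChain G k j y x := by
  induction j generalizing x y with
  | zero => trivial
  | succ j ih =>
    obtain ⟨x', y', h, h'⟩ := h
    exact ⟨y', x', h.symm, ih h'⟩

theorem exists_borderedLink (h : HasLinkChain G k (j + 1) x y) :
    ∃ x' y', BorderedLink G ((j + 1) * k) x y x' y' := by
  induction j generalizing x y with
  | zero =>
    obtain ⟨x', y', h, -⟩ := h
    exact ⟨x', y', by simpa using h⟩
  | succ j ih =>
    obtain ⟨x', y', h, h'⟩ := h
    obtain ⟨x'', y'', h'⟩ := ih h'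
    exact ⟨x'', y'', by convert h.trans h' using 1; ring⟩

end HasLinkChain

/-- The largest number of links of order `k`, up to `N`, in a chain starting at `x`, `y`. -/
noncomputable def linkRank {V : Type*} [LinearOrder V] (G : SimpleGraph V) (N k : ℕ) (x y : V) : ℕ :=
  open Classical in Nat.findGreatest (HasLinkChain G k · x y) N

theorem linkRank_le {V : Type*} [LinearOrder V] (G : SimpleGraph V) (N k : ℕ) (x y : V) :
    linkRank G N k x y ≤ N := by
  classical exact Nat.findGreatest_le N

theorem hasLinkChain_linkRank {V : Type*} [LinearOrder V] (G : SimpleGraph V) (N k : ℕ) (x y : V) :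
    HasLinkChain G k (linkRank G N k x y) x y := by
  classical
  exact Nat.findGreatest_spec (P := fun j => HasLinkChain G k j x y) (Nat.zero_le N) trivial

theorem HasLinkChain.le_linkRank {V : Type*} [LinearOrder V] {G : SimpleGraph V} {N k j : ℕ}
    {x y : V} (h : HasLinkChain G k j x y) (hj : j ≤ N) : j ≤ linkRank G N k x y := by
  classical
  exact Nat.le_findGreatest (P := fun j => HasLinkChain G k j x y) hj h

theorem linkRank_comm {V : Type*} [LinearOrder V] (G : SimpleGraph V) (N k : ℕ) (x y : V) :
    linkRank G N k x y = linkRank G N k y x :=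
  le_antisymm ((hasLinkChain_linkRank G N k x y).symm.le_linkRank (linkRank_le G N k x y))
    ((hasLinkChain_linkRank G N k y x).symm.le_linkRank (linkRank_le G N k y x))

theorem BorderedLink.linkRank_lt {V : Type*} [LinearOrder V] {G : SimpleGraph V} {N k : ℕ}
    {x y x' y' : V} (h : BorderedLink G k x y x' y') (hN : ¬ HasLinkChain G k N x' y') :
    linkRank G N k x' y' < linkRank G N k x y := by
  have h1 := hasLinkChain_linkRank G N k x' y'
  have h2 : linkRank G N k x' y' < N :=
    lt_of_le_of_ne (linkRank_le G N k x' y') fun he => hN (he ▸ h1)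
  exact HasLinkChain.le_linkRank (j := linkRank G N k x' y' + 1) ⟨x', y', h, h1⟩ h2

theorem card_orderedEdges_le_of_not_hasBorderedCycle {V : Type*} [LinearOrder V] [Fintype V]
    (G : SimpleGraph V) (m D : ℕ) (hD : Fintype.card V < D ^ m)
    (hG : ¬ HasBorderedCycle G (Nat.factorial (m - 1) + 1)) :
    (orderedEdges G).card ≤
      m * (2 * Fintype.card V * D) * (Nat.factorial (m - 1) + 1) ^ m := by
  classical
  set M := Nat.factorial (m - 1) with hM
  have hMpos : 0 < M := Nat.factorial_pos _
  have hchain : ∀ k, 1 ≤ k → k < m → ∀ x y, ¬ HasLinkChain G k (M / k) x y := by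
    intro k hk hkm x y h
    have hdvd : k ∣ M := Nat.dvd_factorial hk (by omega)
    obtain ⟨j, hj⟩ : ∃ j, M / k = j + 1 :=
      ⟨M / k - 1, by have := Nat.div_pos (Nat.le_of_dvd hMpos hdvd) hk; omega⟩
    rw [hj] at h
    obtain ⟨x', y', h⟩ := h.exists_borderedLink
    rw [← hj, Nat.div_mul_cancel hdvd] at h
    obtain ⟨p, hp⟩ : ∃ p, M = p + 1 := ⟨M - 1, by omega⟩
    rw [hp] at h hG
    exact hG h.hasBorderedCycle
  let col : V → V → Fin m → Fin (M + 1) := fun x y k =>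
    ⟨linkRank G (M / k) k x y,
      Nat.lt_succ_of_le ((linkRank_le _ _ _ _ _).trans (Nat.div_le_self _ _))⟩
  have hcol : ∀ x y, col x y = col y x := fun x y =>
    funext fun k => Fin.ext (linkRank_comm _ _ _ _ _)
  have hcard : Fintype.card (Fin m → Fin (M + 1)) = (M + 1) ^ m := by simp
  rw [← hcard, ← Finset.card_univ]
  refine Finset.card_le_mul_card_image_of_maps_to (f := fun p => col p.1 p.2)
    (fun _ _ => Finset.mem_univ _) _ fun c _ => ?_
  let H : SimpleGraph V :=
    { Adj := fun x y => G.Adj x y ∧ col x y = c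
      symm := ⟨fun x y h => ⟨h.1.symm, hcol x y ▸ h.2⟩⟩
      loopless := ⟨fun _ h => h.1.ne rfl⟩ }
  have hsub : (orderedEdges G).filter (fun p => col p.1 p.2 = c) ⊆ orderedEdges H := by
    intro p hp
    obtain ⟨hp, hp'⟩ := Finset.mem_filter.1 hp
    rw [mem_orderedEdges] at hp ⊢
    exact ⟨hp.1, hp.2, hp'⟩
  refine (Finset.card_le_card hsub).trans ?_
  by_contra! hlt
  obtain ⟨k, x, y, x', y', hk, hkm, h⟩ := exists_borderedLink_of_card_lt H m D hD hlt
  have hrank := (h.mono (fun _ _ h => h.1 : H ≤ G)).linkRank_lt (hchain k hk hkm x' y')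
  have h1 := congrFun (h.1.2.trans h.2.1.2.symm) ⟨k, hkm⟩
  exact hrank.ne' (Fin.ext_iff.1 h1)

theorem card_edgeSet_le_card_orderedEdges {V : Type*} [LinearOrder V] [Fintype V]
    (G : SimpleGraph V) : Nat.card G.edgeSet ≤ (orderedEdges G).card := by
  rw [← Nat.card_eq_finsetCard]
  refine Nat.card_le_card_of_surjective
    (fun p : orderedEdges G => ⟨s(p.1.1, p.1.2), (mem_orderedEdges.1 p.2).2⟩) ?_
  rintro ⟨e, he⟩
  induction e with
  | h a b =>
    rcases lt_or_gt_of_ne (G.ne_of_adj he) with hab | hab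
    · exact ⟨⟨(a, b), mem_orderedEdges.2 ⟨hab, he⟩⟩, rfl⟩
    · exact ⟨⟨(b, a), mem_orderedEdges.2 ⟨hab, G.adj_symm he⟩⟩, Subtype.ext Sym2.eq_swap⟩

/-- For every integer `m ≥ 2`, setting `k = (m - 1)! + 1`, there is a constant `C > 0` such
that every ordered graph on `n` vertices containing no bordered cycle of length `2 * k` has
at most `C * n ^ (1 + 1/m)` edges. -/
theorem bordered_factorial_upper (m : ℕ) (hm : 2 ≤ m) :
    ∃ C : ℝ, 0 < C ∧
      ∀ (n : ℕ) (G : SimpleGraph (Fin n)),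
        ¬ HasBorderedCycle G (Nat.factorial (m - 1) + 1) →
        (Nat.card G.edgeSet : ℝ) ≤ C * (n : ℝ) ^ (1 + 1 / (m : ℝ)) := by
  have hm0 : (m : ℝ) ≠ 0 := by positivity
  refine ⟨4 * m * (Nat.factorial (m - 1) + 1 : ℝ) ^ m, by positivity, fun n G hG => ?_⟩
  rcases Nat.eq_zero_or_pos n with rfl | hn
  · have : IsEmpty G.edgeSet := ⟨fun e => (Quot.out e.1).1.elim0⟩
    rw [Nat.card_of_isEmpty]
    simp only [Nat.cast_zero]
    positivity
  have hn1 : (1 : ℝ) ≤ n := by exact_mod_cast hn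
  set r : ℝ := (n : ℝ) ^ (1 / (m : ℝ)) with hr
  have hr1 : 1 ≤ r := Real.one_le_rpow hn1 (by positivity)
  have hrm : r ^ m = n := by
    rw [hr, ← Real.rpow_natCast, ← Real.rpow_mul (by positivity), one_div_mul_cancel hm0,
      Real.rpow_one]
  have hfloor : r < (⌊r⌋₊ + 1 : ℕ) := by exact_mod_cast Nat.lt_floor_add_one r
  have hD : Fintype.card (Fin n) < (⌊r⌋₊ + 1) ^ m := by
    rw [Fintype.card_fin]
    have : (n : ℝ) < ((⌊r⌋₊ + 1 : ℕ) : ℝ) ^ m := by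
      rw [← hrm]
      exact pow_lt_pow_left₀ hfloor (by positivity) (by omega)
    exact_mod_cast this
  have h := (card_edgeSet_le_card_orderedEdges G).trans
    (card_orderedEdges_le_of_not_hasBorderedCycle G m _ hD hG)
  rw [Fintype.card_fin] at h
  have h' : (Nat.card G.edgeSet : ℝ) ≤
      m * (2 * n * (⌊r⌋₊ + 1)) * (Nat.factorial (m - 1) + 1) ^ m := by exact_mod_cast h
  have hle : (⌊r⌋₊ : ℝ) + 1 ≤ 2 * r := by
    have := Nat.floor_le (zero_le_one.trans hr1)
    linarith
  calc (Nat.card G.edgeSet : ℝ) ≤ _ := h'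
    _ ≤ m * (2 * n * (2 * r)) * (Nat.factorial (m - 1) + 1) ^ m := by gcongr
    _ = _ := by rw [Real.rpow_add (by positivity), Real.rpow_one]; ring
end
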